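/- arXiv:2001.01239 — 2 statements merged into one kernel-verified Lean document; each statement's English description precedes it below -/
import Mathlib

section
/- Suppose p > p_S. Then there exists λ̲ > 0 such that for every λ ∈ (0, λ̲) the Neumann problem (N) has no nonconstant solution. Moreover, there exists λ̄ > 0 such that for every λ > λ̄ the Neumann problem (N) has no solution U with U'(r) < 0 for all r ∈ (0,1) (i.e. no radially decreasing solution). -/
open Real Set Filter Topology MeasureTheory

noncomputable section

/-- The nonlinearity `f(u) = -u + u^p`. -/
def fNL (p u : ℝ) : ℝ := -u + u ^ p

/-- The Sobolev critical exponent `p_S = (N+2)/(N-2)`. -/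
def pSob (N : ℕ) : ℝ := ((N : ℝ) + 2) / ((N : ℝ) - 2)

/-- `θ = 2/(p-1)`. -/
def thetaP (p : ℝ) : ℝ := 2 / (p - 1)

/-- `A = (θ(N-2-θ))^{1/(p-1)}`. -/
def Aconst (N : ℕ) (p : ℝ) : ℝ :=
  (thetaP p * ((N : ℝ) - 2 - thetaP p)) ^ (1 / (p - 1))

/-- `m = (θ(N-2-θ))^{-1/2}`. -/
def mConst (N : ℕ) (p : ℝ) : ℝ :=
  (thetaP p * ((N : ℝ) - 2 - thetaP p)) ^ (-(1 / 2) : ℝ)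

/-- `α = m(N-2-2θ)`. -/
def alphaConst (N : ℕ) (p : ℝ) : ℝ :=
  mConst N p * ((N : ℝ) - 2 - 2 * thetaP p)

/-- The condition `p < p_JL`, where `p_JL = 1 + 4/(N-4-2√(N-1))` for `N ≥ 11` and
`p_JL = ∞` for `N ≤ 10`. -/
def pJLcond (N : ℕ) (p : ℝ) : Prop :=
  11 ≤ N → p < 1 + 4 / ((N : ℝ) - 4 - 2 * Real.sqrt ((N : ℝ) - 1))

/-- `y` is a C² solution of `y'' + α y' - y + y^p - m² e^{2mt} y = 0` on `(-∞, T]`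
with `y → 1` as `t → -∞`; `y'`, `y''` are its first and second derivatives. -/
def IsSingODEOn (N : ℕ) (p T : ℝ) (y y' y'' : ℝ → ℝ) : Prop :=
  (∀ t ∈ Iic T, HasDerivWithinAt y (y' t) (Iic T) t) ∧
  (∀ t ∈ Iic T, HasDerivWithinAt y' (y'' t) (Iic T) t) ∧
  ContinuousOn y'' (Iic T) ∧
  (∀ t ∈ Iic T, y'' t + alphaConst N p * y' t - y t + y t ^ p
      - (mConst N p) ^ 2 * Real.exp (2 * mConst N p * t) * y t = 0) ∧
  Tendsto y atBot (𝓝 1)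

/-- `y` is a C² solution of `y'' + α y' - y + y^p - m² e^{2mt} y = 0` on all of `ℝ`
with `y → 1` as `t → -∞`. -/
def IsEntireSingODE (N : ℕ) (p : ℝ) (y y' y'' : ℝ → ℝ) : Prop :=
  (∀ t : ℝ, HasDerivAt y (y' t) t) ∧
  (∀ t : ℝ, HasDerivAt y' (y'' t) t) ∧
  Continuous y'' ∧
  (∀ t : ℝ, y'' t + alphaConst N p * y' t - y t + y t ^ p
      - (mConst N p) ^ 2 * Real.exp (2 * mConst N p * t) * y t = 0) ∧
  Tendsto y atBot (𝓝 1)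

/-- The singular solution `u*(s) = A s^{-θ} y*(m⁻¹ log s)` built from `y*`. -/
def ustar (N : ℕ) (p : ℝ) (y : ℝ → ℝ) (s : ℝ) : ℝ :=
  Aconst N p * s ^ (-(thetaP p)) * y (Real.log s / mConst N p)

/-- `u` is a C² solution on `[0,∞)` of the IVP `u'' + ((N-1)/s)u' + f(u) = 0`,
`u(0) = γ`, `u'(0) = 0`, with nonlinearity `f(u) = -u + u^p`. -/
def IsIVPSol (N : ℕ) (p γ : ℝ) (u u' u'' : ℝ → ℝ) : Prop :=
  (∀ s ∈ Ici (0:ℝ), HasDerivWithinAt u (u' s) (Ici 0) s) ∧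
  (∀ s ∈ Ici (0:ℝ), HasDerivWithinAt u' (u'' s) (Ici 0) s) ∧
  ContinuousOn u'' (Ici 0) ∧
  u 0 = γ ∧ u' 0 = 0 ∧
  (∀ s > (0:ℝ), u'' s + ((N : ℝ) - 1) / s * u' s + fNL p (u s) = 0)

/-- `u` is a C² solution on `[0,∞)` of the IVP `u'' + ((N-1)/ρ)u' + u^p = 0`,
`u(0) = γ`, `u'(0) = 0`. -/
def IsBarSol (N : ℕ) (p γ : ℝ) (u u' u'' : ℝ → ℝ) : Prop :=
  (∀ ρ ∈ Ici (0:ℝ), HasDerivWithinAt u (u' ρ) (Ici 0) ρ) ∧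
  (∀ ρ ∈ Ici (0:ℝ), HasDerivWithinAt u' (u'' ρ) (Ici 0) ρ) ∧
  ContinuousOn u'' (Ici 0) ∧
  u 0 = γ ∧ u' 0 = 0 ∧
  (∀ ρ > (0:ℝ), u'' ρ + ((N : ℝ) - 1) / ρ * u' ρ + u ρ ^ p = 0)

/-- `s` is the `(k+1)`-th positive critical point of a function whose derivative is `u'`:
`s` is a positive critical point having exactly `k` positive critical points below it. -/
def IsNthCritPt (u' : ℝ → ℝ) (k : ℕ) (s : ℝ) : Prop :=
  0 < s ∧ u' s = 0 ∧ {x : ℝ | 0 < x ∧ x < s ∧ u' x = 0}.encard = (k : ℕ∞)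

/-- `U` is a positive C² radial solution of the Neumann problem
`U'' + ((N-1)/r)U' + λ f(U) = 0` on `(0,1)`, `U'(0) = U'(1) = 0`, `U > 0` on `[0,1]`. -/
def NeumannSol (N : ℕ) (p lam : ℝ) (U U' U'' : ℝ → ℝ) : Prop :=
  (∀ r ∈ Icc (0:ℝ) 1, HasDerivWithinAt U (U' r) (Icc 0 1) r) ∧
  (∀ r ∈ Icc (0:ℝ) 1, HasDerivWithinAt U' (U'' r) (Icc 0 1) r) ∧
  ContinuousOn U'' (Icc 0 1) ∧
  (∀ r ∈ Ioo (0:ℝ) 1, U'' r + ((N : ℝ) - 1) / r * U' r + lam * fNL p (U r) = 0) ∧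
  U' 0 = 0 ∧ U' 1 = 0 ∧ (∀ r ∈ Icc (0:ℝ) 1, 0 < U r)

/-- `(lam, U)` is a singular solution of the Neumann problem whose graph meets `1`
exactly `n` times: `U` is C² on `(0,1)`, continuous on `(0,1]`, `U'(1) = 0`, it solves
`U'' + ((N-1)/r)U' + λ f(U) = 0` on `(0,1)`, satisfies the asymptotics
`U(r) = A(√λ r)^{-θ}(1+o(1))` as `r ↓ 0` (i.e. `r^θ U(r) → A λ^{-θ/2}`),
`U - 1` has exactly `n` zeros in `(0,1]`, and `U > 0` on `(0,1]`. -/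
def SingBVPSol (N : ℕ) (p lam : ℝ) (n : ℕ) (U U' U'' : ℝ → ℝ) : Prop :=
  (∀ r ∈ Ioc (0:ℝ) 1, HasDerivWithinAt U (U' r) (Ioc 0 1) r) ∧
  (∀ r ∈ Ioo (0:ℝ) 1, HasDerivAt U' (U'' r) r) ∧
  ContinuousOn U (Ioc 0 1) ∧
  ContinuousOn U'' (Ioo 0 1) ∧
  (∀ r ∈ Ioo (0:ℝ) 1, U'' r + ((N : ℝ) - 1) / r * U' r + lam * fNL p (U r) = 0) ∧
  U' 1 = 0 ∧
  Tendsto (fun r => r ^ thetaP p * U r) (𝓝[>] (0:ℝ))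
    (𝓝 (Aconst N p * lam ^ (-(thetaP p) / 2))) ∧
  {r ∈ Ioc (0:ℝ) 1 | U r = 1}.encard = (n : ℕ∞) ∧
  (∀ r ∈ Ioc (0:ℝ) 1, 0 < U r)

/-- A function with nonpositive derivative in the interior of an interval decreases across it. -/
theorem le_of_hasDerivAt_nonpos {f f' : ℝ → ℝ} {a b : ℝ} (hab : a ≤ b)
    (hc : ContinuousOn f (Icc a b)) (hd : ∀ x ∈ Ioo a b, HasDerivAt f (f' x) x)
    (hn : ∀ x ∈ Ioo a b, f' x ≤ 0) : f b ≤ f a := by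
  refine antitoneOn_of_deriv_nonpos (convex_Icc a b) hc ?_ ?_ (left_mem_Icc.2 hab)
    (right_mem_Icc.2 hab) hab
  · rw [interior_Icc]
    exact fun x hx => (hd x hx).differentiableAt.differentiableWithinAt
  · rw [interior_Icc]
    intro x hx
    rw [(hd x hx).deriv]
    exact hn x hx

theorem abs_sub_le_of_hasDerivAt {f f' g g' : ℝ → ℝ} {a b : ℝ} (hab : a ≤ b)
    (hf : ContinuousOn f (Icc a b)) (hf' : ∀ x ∈ Ioo a b, HasDerivAt f (f' x) x)
    (hg : ContinuousOn g (Icc a b)) (hg' : ∀ x ∈ Ioo a b, HasDerivAt g (g' x) x)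
    (hle : ∀ x ∈ Ioo a b, |f' x| ≤ g' x) : |f b - f a| ≤ g b - g a := by
  have h1 := le_of_hasDerivAt_nonpos hab (hf.sub hg)
    (fun x hx => (hf' x hx).sub (hg' x hx)) fun x hx => by
      linarith [(abs_le.1 (hle x hx)).2]
  have h2 := le_of_hasDerivAt_nonpos hab (hf.neg.sub hg)
    (fun x hx => (hf' x hx).neg.sub (hg' x hx)) fun x hx => by
      linarith [(abs_le.1 (hle x hx)).1]
  simp only [Pi.sub_apply, Pi.neg_apply] at h1 h2
  rw [abs_le]
  constructor <;> linarith

/-- The tangent line inequality for `t ↦ t ^ p`. -/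
theorem rpow_sub_rpow_le {p x y : ℝ} (hp : 1 < p) (hx : 0 < x) (hy : 0 < y) :
    x ^ p - y ^ p ≤ p * x ^ (p - 1) * (x - y) := by
  have h1 := one_add_mul_self_le_rpow_one_add (s := y / x - 1)
    (by linarith [div_pos hy hx]) hp.le
  rw [add_sub_cancel, Real.div_rpow hy.le hx.le, le_div_iff₀ (Real.rpow_pos_of_pos hx p)] at h1
  have h2 : x ^ p = x ^ (p - 1) * x := by
    rw [← Real.rpow_add_one hx.ne', sub_add_cancel]
  have h3 : (1 + p * (y / x - 1)) * x ^ p = x ^ p + p * x ^ (p - 1) * (y - x) := by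
    rw [h2]
    field_simp
  linarith

theorem abs_rpow_sub_rpow_le {p x y A : ℝ} (hp : 1 < p) (hx : 0 < x) (hy : 0 < y)
    (hxA : x ^ (p - 1) ≤ A) (hyA : y ^ (p - 1) ≤ A) : |x ^ p - y ^ p| ≤ p * A * |x - y| := by
  wlog hxy : y ≤ x generalizing x y
  · rw [abs_sub_comm, abs_sub_comm x y]
    exact this hy hx hyA hxA (le_of_not_ge hxy)
  have h1 : y ^ p ≤ x ^ p := Real.rpow_le_rpow hy.le hxy (by linarith)
  rw [abs_of_nonneg (sub_nonneg.2 h1), abs_of_nonneg (sub_nonneg.2 hxy)]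
  refine (rpow_sub_rpow_le hp hx hy).trans ?_
  have : 0 ≤ x - y := sub_nonneg.2 hxy
  gcongr

/-- A continuous function that passes from at most `a` to at least `b` crosses the
strip between `a` and `b`. -/
theorem exists_crossing {V : ℝ → ℝ} {l u a b : ℝ} (hlu : l ≤ u)
    (hV : ContinuousOn V (Icc l u)) (hl : V l ≤ a) (hu : b ≤ V u) :
    ∃ x y, l ≤ x ∧ x ≤ y ∧ y ≤ u ∧ V x ≤ a ∧ b ≤ V y ∧
      ∀ z ∈ Ioo x y, a < V z ∧ V z < b := by
  have hc : IsCompact (Icc l u ∩ V ⁻¹' Iic a) :=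
    isCompact_Icc.of_isClosed_subset (hV.preimage_isClosed_of_isClosed isClosed_Icc isClosed_Iic)
      inter_subset_left
  obtain ⟨x, ⟨hx, hxa⟩, hxm⟩ := hc.exists_isGreatest ⟨l, left_mem_Icc.2 hlu, hl⟩
  have hVx : ContinuousOn V (Icc x u) := hV.mono (Icc_subset_Icc_left hx.1)
  have hc' : IsCompact (Icc x u ∩ V ⁻¹' Ici b) :=
    isCompact_Icc.of_isClosed_subset (hVx.preimage_isClosed_of_isClosed isClosed_Icc isClosed_Ici)
      inter_subset_left
  obtain ⟨y, ⟨hy, hyb⟩, hym⟩ := hc'.exists_isLeast ⟨u, right_mem_Icc.2 hx.2, hu⟩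
  refine ⟨x, y, hx.1, hy.1, hy.2, hxa, hyb, fun z hz => ⟨?_, ?_⟩⟩
  · by_contra! hcon
    exact absurd (hxm ⟨⟨hx.1.trans hz.1.le, hz.2.le.trans hy.2⟩, hcon⟩) (not_le.2 hz.1)
  · by_contra! hcon
    exact absurd (hym ⟨⟨hz.1.le, hz.2.le.trans hy.2⟩, hcon⟩) (not_le.2 hz.2)

/-- Away from `0`, `u ^ p - u` is at least linear in the distance to its zero `1`. -/
theorem exists_linear_bound_rpow_sub {p δ : ℝ} (hp : 1 < p) (hδ : 0 < δ) (hδ1 : δ < 1) :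
    ∃ c > 0, ∀ u, δ ≤ u →
      (1 ≤ u → c * (u - 1) ≤ -u + u ^ p) ∧ (u ≤ 1 → -u + u ^ p ≤ -(c * (1 - u))) := by
  have hδp : 0 < δ - δ ^ p := by
    have := Real.rpow_lt_rpow_of_exponent_gt hδ hδ1 hp
    rw [Real.rpow_one] at this
    linarith
  refine ⟨min (p - 1) (δ - δ ^ p), lt_min (by linarith) hδp, fun u hu => ⟨fun h1 => ?_, fun h1 => ?_⟩⟩
  · have e1 := rpow_sub_rpow_le hp one_pos (hδ.trans_le hu)
    rw [Real.one_rpow, Real.one_rpow] at e1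
    have e2 : min (p - 1) (δ - δ ^ p) * (u - 1) ≤ (p - 1) * (u - 1) :=
      mul_le_mul_of_nonneg_right (min_le_left _ _) (by linarith)
    linarith
  · have hd : 0 < 1 - δ := by linarith
    have e1 : 0 ≤ (1 - u) / (1 - δ) := div_nonneg (by linarith) hd.le
    have e2 : 0 ≤ (u - δ) / (1 - δ) := div_nonneg (by linarith) hd.le
    have e3 : (1 - u) / (1 - δ) + (u - δ) / (1 - δ) = 1 := by
      field_simp
      ring
    have e4 := (convexOn_rpow hp.le).2 (mem_Ici.2 hδ.le) (mem_Ici.2 zero_le_one) e1 e2 e3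
    have e5 : (1 - u) / (1 - δ) * δ + (u - δ) / (1 - δ) * 1 = u := by
      field_simp
      ring
    simp only [smul_eq_mul, Real.one_rpow] at e4
    rw [e5] at e4
    have e6 : (1 - u) * (δ - δ ^ p) ≤ (1 - u) / (1 - δ) * (δ - δ ^ p) := by
      refine mul_le_mul_of_nonneg_right ?_ hδp.le
      rw [le_div_iff₀ hd]
      nlinarith
    have e7 : min (p - 1) (δ - δ ^ p) * (1 - u) ≤ (δ - δ ^ p) * (1 - u) :=
      mul_le_mul_of_nonneg_right (min_le_right _ _) (by linarith)
    linarith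

/-- In the strip `K b ≤ V ≤ 2 K b`, an energy close to zero forces a large slope `D`. -/
theorem mul_le_abs_of_energy_ge {p lam B b K σ V D z : ℝ} (hp : 1 < p) (hlam : 0 < lam)
    (hb : 0 < b) (hσ0 : 0 < σ) (hσ : σ ^ 2 = B / 2) (hK : 0 < K)
    (hK1 : 4 * (B + 1) ≤ B * K ^ 2) (hsmall : lam * (2 * K * b) ^ (p - 1) ≤ B / 4)
    (hV : 0 < V) (hlo : K * b ≤ V) (hhi : V ≤ 2 * K * b)
    (hE : -((B + 1) * b ^ 2 / 2) ≤
      D ^ 2 / 2 + lam * (V ^ (p + 1) / (p + 1)) - (B + lam * z ^ 2) * V ^ 2 / 2) :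
    σ * V ≤ |D| := by
  have hp1 : 0 < p + 1 := by linarith
  have hB : 0 < B := by linarith [pow_pos hσ0 2]
  have hV2 : 0 < V ^ 2 := by positivity
  have h1 : V ^ (p + 1) = V ^ (p - 1) * V ^ 2 := by
    rw [← Real.rpow_natCast V 2, ← Real.rpow_add hV]
    congr 1
    push_cast
    ring
  have h2 : lam * V ^ (p - 1) ≤ B / 4 := by
    refine le_trans ?_ hsmall
    have : V ^ (p - 1) ≤ (2 * K * b) ^ (p - 1) := Real.rpow_le_rpow hV.le hhi (by linarith)
    gcongr
  have h3 : lam * (V ^ (p + 1) / (p + 1)) ≤ B / 8 * V ^ 2 := by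
    have e1 : lam * (V ^ (p + 1) / (p + 1)) = lam * V ^ (p - 1) * V ^ 2 / (p + 1) := by
      rw [h1]
      ring
    rw [e1, div_le_iff₀ hp1]
    have e2 : lam * V ^ (p - 1) * V ^ 2 ≤ B / 4 * V ^ 2 := by gcongr
    have e3 : B / 8 * V ^ 2 * 2 ≤ B / 8 * V ^ 2 * (p + 1) := by gcongr; linarith
    linarith
  have h4 : (B + 1) * b ^ 2 ≤ B / 4 * V ^ 2 := by
    have e1 : (K * b) ^ 2 ≤ V ^ 2 := by gcongr
    have e2 : B / 4 * (K * b) ^ 2 ≤ B / 4 * V ^ 2 := by gcongr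
    have e3 : 4 * (B + 1) * b ^ 2 ≤ B * K ^ 2 * b ^ 2 := by gcongr
    have e4 : B / 4 * (K * b) ^ 2 = B * K ^ 2 * b ^ 2 / 4 := by ring
    linarith
  have h5 : 0 ≤ lam * z ^ 2 * V ^ 2 := by positivity
  refine (pow_le_pow_iff_left₀ (by positivity) (abs_nonneg _) two_ne_zero).1 ?_
  rw [sq_abs, mul_pow, hσ]
  linarith

namespace NeumannSol

variable {k N : ℕ} {p lam : ℝ} {U U' U'' : ℝ → ℝ}

theorem continuousOn (h : NeumannSol N p lam U U' U'') : ContinuousOn U (Icc 0 1) :=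
  fun r hr => (h.1 r hr).continuousWithinAt

theorem continuousOn' (h : NeumannSol N p lam U U' U'') : ContinuousOn U' (Icc 0 1) :=
  fun r hr => (h.2.1 r hr).continuousWithinAt

theorem hasDerivAt (h : NeumannSol N p lam U U' U'') {r : ℝ} (hr : r ∈ Ioo (0 : ℝ) 1) :
    HasDerivAt U (U' r) r :=
  (h.1 r (Ioo_subset_Icc_self hr)).hasDerivAt (Icc_mem_nhds hr.1 hr.2)

theorem hasDerivAt' (h : NeumannSol N p lam U U' U'') {r : ℝ} (hr : r ∈ Ioo (0 : ℝ) 1) :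
    HasDerivAt U' (U'' r) r :=
  (h.2.1 r (Ioo_subset_Icc_self hr)).hasDerivAt (Icc_mem_nhds hr.1 hr.2)

theorem deriv_zero (h : NeumannSol N p lam U U' U'') : U' 0 = 0 := h.2.2.2.2.1

theorem deriv_one (h : NeumannSol N p lam U U' U'') : U' 1 = 0 := h.2.2.2.2.2.1

theorem pos (h : NeumannSol N p lam U U' U'') {r : ℝ} (hr : r ∈ Icc (0 : ℝ) 1) : 0 < U r :=
  h.2.2.2.2.2.2 r hr

theorem second_deriv_eq (h : NeumannSol (k + 1) p lam U U' U'') {r : ℝ}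
    (hr : r ∈ Ioo (0 : ℝ) 1) : U'' r = -(k / r * U' r) - lam * (-U r + U r ^ p) := by
  have := h.2.2.2.1 r hr
  simp only [fNL] at this
  push_cast at this
  rw [add_sub_cancel_right] at this
  linarith

theorem hasDerivAt_flux (h : NeumannSol (k + 1) p lam U U' U'') {r : ℝ}
    (hr : r ∈ Ioo (0 : ℝ) 1) :
    HasDerivAt (fun r => r ^ k * U' r) (-(lam * r ^ k * (-U r + U r ^ p))) r := by
  have h1 := (hasDerivAt_pow k r).mul (h.hasDerivAt' hr)
  refine h1.congr_deriv ?_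
  rw [h.second_deriv_eq hr]
  have hr0 : r ≠ 0 := hr.1.ne'
  rcases k with _ | k
  · simp
  · rw [Nat.add_sub_cancel, pow_succ]
    field_simp
    ring

/-- The Pohozaev functional. -/
def pohozaev (k : ℕ) (p lam : ℝ) (U U' : ℝ → ℝ) (r : ℝ) : ℝ :=
  r ^ (k + 1) * (U' r ^ 2 / 2 + lam * (-(U r ^ 2 / 2) + U r ^ (p + 1) / (p + 1)))
    + (k + 1) / (p + 1) * (U r * (r ^ k * U' r))

theorem continuousOn_pohozaev (h : NeumannSol (k + 1) p lam U U' U'') (hp : 1 < p) :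
    ContinuousOn (pohozaev k p lam U U') (Icc 0 1) := by
  have h1 := h.continuousOn
  have h2 := h.continuousOn'
  have h3 : ContinuousOn (fun r => U r ^ (p + 1)) (Icc 0 1) :=
    h1.rpow_const fun x hx => Or.inr (by linarith)
  unfold pohozaev
  fun_prop

theorem hasDerivAt_pohozaev (h : NeumannSol (k + 1) p lam U U' U'') (hp : 1 < p) {r : ℝ}
    (hr : r ∈ Ioo (0 : ℝ) 1) :
    HasDerivAt (pohozaev k p lam U U')
      (-(r ^ k * (((k - 1) / 2 - (k + 1) / (p + 1)) * U' r ^ 2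
        + lam * ((k + 1) / 2 - (k + 1) / (p + 1)) * U r ^ 2))) r := by
  have hU := h.pos (Ioo_subset_Icc_self hr)
  have h1 := h.hasDerivAt hr
  have h2 := h.hasDerivAt' hr
  have h3 : HasDerivAt (fun r => U r ^ (p + 1)) (U' r * (p + 1) * U r ^ p) r := by
    have := h1.rpow_const (p := p + 1) (Or.inl hU.ne')
    rwa [add_sub_cancel_right] at this
  have h4 := ((hasDerivAt_pow (k + 1) r).mul (((h2.pow 2).div_const 2).add
    ((((h1.pow 2).div_const 2).neg.add (h3.div_const (p + 1))).const_mul lam))).add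
    ((h1.mul (h.hasDerivAt_flux hr)).const_mul ((k + 1) / (p + 1) : ℝ))
  refine h4.congr_deriv ?_
  simp only [Pi.add_apply, Pi.neg_apply, Pi.pow_apply]
  rw [h.second_deriv_eq hr, Real.rpow_add_one hU.ne']
  have hr0 : r ≠ 0 := hr.1.ne'
  have hp0 : p + 1 ≠ 0 := by linarith
  push_cast
  simp only [pow_succ]
  field_simp
  ring

theorem pohozaev_zero (hk : 1 ≤ k) : pohozaev k p lam U U' 0 = 0 := by
  have : k ≠ 0 := by omega
  simp [pohozaev, this]

theorem pohozaev_one (h : NeumannSol (k + 1) p lam U U' U'') :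
    pohozaev k p lam U U' 1 = lam * (-(U 1 ^ 2 / 2) + U 1 ^ (p + 1) / (p + 1)) := by
  simp [pohozaev, h.deriv_one]

theorem rpow_boundary_le (h : NeumannSol (k + 1) p lam U U' U'') (hk : 2 ≤ k) (hp : 1 < p)
    (hlam : 0 < lam) (hS : (k + 1 : ℝ) / (p + 1) < (k - 1) / 2) :
    U 1 ^ (p - 1) ≤ (p + 1) / 2 := by
  have hmono : pohozaev k p lam U U' 1 ≤ pohozaev k p lam U U' 0 := by
    refine le_of_hasDerivAt_nonpos zero_le_one (h.continuousOn_pohozaev hp)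
      (fun x hx => h.hasDerivAt_pohozaev hp hx) fun x hx => ?_
    have h1 : (0 : ℝ) ≤ (k - 1) / 2 - (k + 1) / (p + 1) := by linarith
    have h2 : (0 : ℝ) ≤ (k + 1) / 2 - (k + 1) / (p + 1) := by linarith
    have := hx.1.le
    rw [neg_nonpos]
    positivity
  rw [h.pohozaev_one, pohozaev_zero (by omega)] at hmono
  have hU := h.pos (right_mem_Icc.2 (zero_le_one' ℝ))
  have h3 : -(U 1 ^ 2 / 2) + U 1 ^ (p + 1) / (p + 1) ≤ 0 := by
    by_contra! hcon
    exact absurd hmono (not_le.2 (mul_pos hlam hcon))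
  have h4 : U 1 ^ (p + 1) = U 1 ^ (p - 1) * U 1 ^ 2 := by
    rw [← Real.rpow_natCast (U 1) 2, ← Real.rpow_add hU]
    congr 1
    push_cast
    ring
  rw [h4] at h3
  have hp0 : 0 < p + 1 := by linarith
  have h5 : U 1 ^ (p - 1) / (p + 1) * U 1 ^ 2 ≤ 1 / 2 * U 1 ^ 2 := by
    have : U 1 ^ (p - 1) / (p + 1) * U 1 ^ 2 = U 1 ^ (p - 1) * U 1 ^ 2 / (p + 1) := by ring
    linarith
  have h6 := le_of_mul_le_mul_right h5 (by positivity)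
  rw [div_le_iff₀ hp0] at h6
  linarith

/-- The logarithmic derivative `r (r^θ U)'` of the Emden-Fowler variable. -/
def emdenSlope (θ : ℝ) (U U' : ℝ → ℝ) (r : ℝ) : ℝ := r ^ θ * (θ * U r + r * U' r)

/-- The energy of the Emden-Fowler variable `r^θ U`. -/
def emdenEnergy (θ B p lam : ℝ) (U U' : ℝ → ℝ) (r : ℝ) : ℝ :=
  emdenSlope θ U U' r ^ 2 / 2 + lam * ((r ^ θ * U r) ^ (p + 1) / (p + 1))
    - (B + lam * r ^ 2) * (r ^ θ * U r) ^ 2 / 2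

theorem continuousOn_emden (h : NeumannSol N p lam U U' U'') {θ : ℝ} (hθ : 0 < θ) :
    ContinuousOn (fun r => r ^ θ * U r) (Icc 0 1) := by
  have h1 := h.continuousOn
  have h3 : ContinuousOn (fun r : ℝ => r ^ θ) (Icc 0 1) :=
    continuousOn_id.rpow_const fun x hx => Or.inr hθ.le
  fun_prop

theorem continuousOn_emdenEnergy (h : NeumannSol N p lam U U' U'') (hp : 1 < p) {θ : ℝ}
    (hθ : 0 < θ) (B : ℝ) : ContinuousOn (emdenEnergy θ B p lam U U') (Icc 0 1) := by
  have h1 := h.continuousOn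
  have h2 := h.continuousOn'
  have h3 : ContinuousOn (fun r : ℝ => r ^ θ) (Icc 0 1) :=
    continuousOn_id.rpow_const fun x hx => Or.inr hθ.le
  have h4 : ContinuousOn (fun r => (r ^ θ * U r) ^ (p + 1)) (Icc 0 1) :=
    (h.continuousOn_emden hθ).rpow_const fun x hx => Or.inr (by linarith)
  unfold emdenEnergy emdenSlope
  fun_prop

theorem hasDerivAt_emden (h : NeumannSol N p lam U U' U'') (θ : ℝ) {r : ℝ}
    (hr : r ∈ Ioo (0 : ℝ) 1) :
    HasDerivAt (fun r => r ^ θ * U r) (emdenSlope θ U U' r / r) r := by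
  have h1 := (Real.hasDerivAt_rpow_const (p := θ) (Or.inl hr.1.ne')).mul (h.hasDerivAt hr)
  refine h1.congr_deriv ?_
  have hr0 : r ≠ 0 := hr.1.ne'
  rw [emdenSlope, Real.rpow_sub_one hr0]
  field_simp

theorem hasDerivAt_emdenEnergy (h : NeumannSol (k + 1) p lam U U' U'') (hp : 1 < p) {θ : ℝ}
    (hθ : θ * (p - 1) = 2) {r : ℝ} (hr : r ∈ Ioo (0 : ℝ) 1) :
    HasDerivAt (emdenEnergy θ (θ * (k - 1 - θ)) p lam U U')
      (-((k - 1 - 2 * θ) * emdenSlope θ U U' r ^ 2 + lam * r ^ 2 * (r ^ θ * U r) ^ 2) / r) r := by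
  have hU := h.pos (Ioo_subset_Icc_self hr)
  have hr0 : r ≠ 0 := hr.1.ne'
  have h1 := h.hasDerivAt hr
  have h2 := h.hasDerivAt' hr
  have h5 := h.hasDerivAt_emden θ hr
  have hV : 0 < r ^ θ * U r := mul_pos (Real.rpow_pos_of_pos hr.1 _) hU
  have h3 : HasDerivAt (fun r => (r ^ θ * U r) ^ (p + 1))
      (emdenSlope θ U U' r / r * (p + 1) * (r ^ θ * U r) ^ p) r := by
    have := h5.rpow_const (p := p + 1) (Or.inl hV.ne')
    rwa [add_sub_cancel_right] at this
  have hpow : (r ^ θ * U r) ^ p = r ^ θ * r ^ 2 * U r ^ p := by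
    rw [Real.mul_rpow (Real.rpow_nonneg hr.1.le _) hU.le, ← Real.rpow_mul hr.1.le,
      ← Real.rpow_natCast r 2, ← Real.rpow_add hr.1]
    congr 2
    push_cast
    linarith
  have h6 : HasDerivAt (emdenSlope θ U U') (θ * r ^ (θ - 1) * (θ * U r + r * U' r)
      + r ^ θ * (θ * U' r + (1 * U' r + r * U'' r))) r :=
    (Real.hasDerivAt_rpow_const (p := θ) (Or.inl hr0)).mul
      ((h1.const_mul θ).add ((hasDerivAt_id r).mul h2))
  have h4 := (((h6.pow 2).div_const 2).add ((h3.div_const (p + 1)).const_mul lam)).sub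
    ((((((hasDerivAt_id r).pow 2).const_mul lam).const_add (θ * (k - 1 - θ))).mul
      (h5.pow 2)).div_const 2)
  refine h4.congr_deriv ?_
  simp only [Pi.pow_apply, id]
  rw [h.second_deriv_eq hr, hpow, Real.rpow_sub_one hr0]
  have hp0 : p + 1 ≠ 0 := by linarith
  simp only [emdenSlope]
  push_cast
  field_simp
  ring

theorem emdenEnergy_antitone (h : NeumannSol (k + 1) p lam U U' U'') (hp : 1 < p)
    (hlam : 0 < lam) {θ : ℝ} (hθ0 : 0 < θ) (hθ : θ * (p - 1) = 2) (hα : 0 < k - 1 - 2 * θ)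
    {x y : ℝ} (hx : 0 ≤ x) (hxy : x ≤ y) (hy : y ≤ 1) :
    emdenEnergy θ (θ * (k - 1 - θ)) p lam U U' y
      ≤ emdenEnergy θ (θ * (k - 1 - θ)) p lam U U' x := by
  refine le_of_hasDerivAt_nonpos hxy
    ((h.continuousOn_emdenEnergy hp hθ0 _).mono (Icc_subset_Icc hx hy))
    (fun r hr => h.hasDerivAt_emdenEnergy hp hθ ⟨hx.trans_lt hr.1, hr.2.trans_le hy⟩)
    fun r hr => ?_
  have : 0 < r := hx.trans_lt hr.1
  rw [neg_div, neg_nonpos]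
  positivity

set_option maxHeartbeats 1000000 in
theorem emden_le (h : NeumannSol (k + 1) p lam U U' U'') (hp : 1 < p) (hlam : 0 < lam)
    (hlam1 : lam ≤ 1) {θ α B σ K : ℝ} (hθ0 : 0 < θ) (hθ : θ * (p - 1) = 2)
    (hα : α = k - 1 - 2 * θ) (hα0 : 0 < α) (hB : B = θ * (k - 1 - θ)) (hσ0 : 0 < σ)
    (hσ : σ ^ 2 = B / 2) (hK : 0 < K) (hK1 : 4 * (B + 1) ≤ B * K ^ 2)
    (hK2 : B + 1 < 3 * α * σ * K ^ 2) (hsmall : lam * (2 * K * U 1) ^ (p - 1) ≤ B / 4)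
    {r : ℝ} (hr : r ∈ Icc (0 : ℝ) 1) : r ^ θ * U r ≤ 2 * K * U 1 := by
  have hb := h.pos (right_mem_Icc.2 (zero_le_one' ℝ))
  set b := U 1 with hb_def
  by_contra! hcon
  have hp1 : 0 < p + 1 := by linarith
  set E := emdenEnergy θ (θ * (k - 1 - θ)) p lam U U' with hE
  set V : ℝ → ℝ := fun r => r ^ θ * U r with hV
  set D := emdenSlope θ U U' with hD
  have hVpos : ∀ r ∈ Ioc (0 : ℝ) 1, 0 < V r := fun r hr =>
    mul_pos (Real.rpow_pos_of_pos hr.1 _) (h.pos (Ioc_subset_Icc_self hr))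
  have hE0 : E 0 = 0 := by
    have : p + 1 ≠ 0 := hp1.ne'
    simp [hE, emdenEnergy, emdenSlope, Real.zero_rpow hθ0.ne', Real.zero_rpow this]
  have hE1 : -((B + 1) * b ^ 2 / 2) ≤ E 1 := by
    have h1 : 0 ≤ lam * (b ^ (p + 1) / (p + 1)) := by positivity
    have h2 : lam * b ^ 2 ≤ 1 * b ^ 2 := by gcongr
    simp only [hE, emdenEnergy, Real.one_rpow, one_mul, one_pow, ← hB, ← hb_def, mul_one]
    nlinarith [sq_nonneg (emdenSlope θ U U' 1)]
  have hmono : ∀ x y, 0 ≤ x → x ≤ y → y ≤ 1 → E y ≤ E x := fun x y =>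
    h.emdenEnergy_antitone hp hlam hθ0 hθ (hα ▸ hα0)
  obtain ⟨x, y, hx, hxy, hy, hVx, hVy, hstrip⟩ := exists_crossing (a := K * b) (b := 2 * K * b)
    hr.1 ((h.continuousOn_emden hθ0).mono (Icc_subset_Icc_right hr.2))
    (by simp only [Real.zero_rpow hθ0.ne', zero_mul]; positivity) hcon.le
  have hy1 : y ≤ 1 := hy.trans hr.2
  have hx0 : 0 ≤ V x := mul_nonneg (Real.rpow_nonneg hx _) (h.pos ⟨hx, hxy.trans hy1⟩).le
  have key : ∀ z ∈ Ioo x y, σ * V z ≤ |D z| := by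
    intro z hz
    have hz0 : 0 < z := hx.trans_lt hz.1
    have hz1 : z ≤ 1 := hz.2.le.trans hy1
    have hVz := hVpos z ⟨hz0, hz1⟩
    obtain ⟨hlo, hhi⟩ := hstrip z hz
    change K * b < V z at hlo
    change V z < 2 * K * b at hhi
    have e1 : E 1 ≤ E z := hmono z 1 hz0.le hz1 le_rfl
    have e2 : E z = D z ^ 2 / 2 + lam * (V z ^ (p + 1) / (p + 1))
      - (B + lam * z ^ 2) * V z ^ 2 / 2 := by
      rw [hB]
      rfl
    exact mul_le_abs_of_energy_ge hp hlam hb hσ0 hσ hK hK1 hsmall hVz hlo.le hhi.le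
      (e2 ▸ hE1.trans e1)
  have hfin := le_of_hasDerivAt_nonpos (f := fun z => E z + α * σ / 2 * V z ^ 2) hxy
    (((h.continuousOn_emdenEnergy hp hθ0 _).add
      (((h.continuousOn_emden hθ0).pow 2).const_smul (α * σ / 2))).mono (Icc_subset_Icc hx hy1))
    (fun z hz => (h.hasDerivAt_emdenEnergy hp hθ ⟨hx.trans_lt hz.1, hz.2.trans_le hy1⟩).add
      (((h.hasDerivAt_emden θ ⟨hx.trans_lt hz.1, hz.2.trans_le hy1⟩).pow 2).const_mul _))
    fun z hz => by
      have hz0 : 0 < z := hx.trans_lt hz.1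
      have hVz := hVpos z ⟨hz0, hz.2.le.trans hy1⟩
      have h1 := key z hz
      have h2 : σ * V z * D z ≤ D z ^ 2 := by
        rw [← sq_abs (D z)]
        nlinarith [le_abs_self (D z), mul_pos hσ0 hVz, abs_nonneg (D z)]
      have h3 : 0 ≤ lam * z ^ 2 * V z ^ 2 := by positivity
      have h4 : -((k - 1 - 2 * θ) * D z ^ 2 + lam * z ^ 2 * V z ^ 2) / z
          + α * σ / 2 * (((2 : ℕ) : ℝ) * V z ^ (2 - 1) * (D z / z))
          = (α * (σ * V z * D z - D z ^ 2) - lam * z ^ 2 * V z ^ 2) / z := by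
        rw [← hα]
        push_cast
        field_simp
        ring
      refine le_of_eq_of_le h4 (div_nonpos_of_nonpos_of_nonneg ?_ hz0.le)
      nlinarith [mul_nonneg hα0.le (sub_nonneg.2 h2)]
  have h1 : E x ≤ 0 := hE0 ▸ hmono 0 x le_rfl hx (hxy.trans hy1)
  have h2 : -((B + 1) * b ^ 2 / 2) ≤ E y := hE1.trans (hmono y 1 (hx.trans hxy) hy1 le_rfl)
  have h3 : V x ^ 2 ≤ (K * b) ^ 2 := by
    change V x ≤ _ at hVx
    gcongr
  have h4 : (2 * K * b) ^ 2 ≤ V y ^ 2 := by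
    change _ ≤ V y at hVy
    gcongr
  have h5 : 0 < α * σ / 2 := by positivity
  have hb2 : 0 < b ^ 2 := by positivity
  have h6 := mul_le_mul_of_nonneg_left h3 h5.le
  have h7 := mul_le_mul_of_nonneg_left h4 h5.le
  have h8 := mul_lt_mul_of_pos_right hK2 hb2
  have h9 : E y + α * σ / 2 * V y ^ 2 ≤ E x + α * σ / 2 * V x ^ 2 := hfin
  clear_value E V
  linarith

/-- A Neumann solution whose Emden-Fowler variable is bounded is constant when `λ` is small. -/
theorem eq_of_emden_le (h : NeumannSol (k + 1) p lam U U' U'') (hk : 2 ≤ k) (hp : 1 < p)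
    (hlam : 0 < lam) {θ M : ℝ} (hθ : θ * (p - 1) = 2)
    (hM : ∀ r ∈ Icc (0 : ℝ) 1, r ^ θ * U r ≤ M)
    (hsmall : 8 * lam * (1 + p * M ^ (p - 1)) < 1) {r : ℝ} (hr : r ∈ Icc (0 : ℝ) 1) :
    U r = U 0 := by
  have hb := h.pos (right_mem_Icc.2 (zero_le_one' ℝ))
  have hbM : U 1 ≤ M := by simpa using hM 1 (right_mem_Icc.2 zero_le_one)
  have hM0 : 0 < M := hb.trans_le hbM
  set b := U 1 with hb_def
  set A := M ^ (p - 1) with hA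
  have hA0 : 0 < A := Real.rpow_pos_of_pos hM0 _
  set L := 1 + p * A with hL
  have hL0 : 0 < L := by positivity
  have hk' : (2 : ℝ) ≤ k := by exact_mod_cast hk
  have hbA : b ^ (p - 1) ≤ A := Real.rpow_le_rpow hb.le hbM (by linarith)
  have hlip : ∀ x ∈ Ioo (0 : ℝ) 1,
      |(-U x + U x ^ p) - (-b + b ^ p)| ≤ L * x ^ (-2 : ℝ) * |U x - b| := by
    intro x hx
    have hU := h.pos (Ioo_subset_Icc_self hx)
    have hx2 : x ^ (-2 : ℝ) = (x ^ 2)⁻¹ := by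
      rw [Real.rpow_neg hx.1.le, ← Real.rpow_natCast]
      norm_num
    have h1 : 1 ≤ x ^ (-2 : ℝ) := by
      rw [hx2]
      exact (one_le_inv₀ (pow_pos hx.1 2)).2 (pow_le_one₀ hx.1.le hx.2.le)
    have h2 : x ^ 2 * U x ^ (p - 1) ≤ A := by
      have := Real.rpow_le_rpow (by have := hx.1; positivity) (hM x (Ioo_subset_Icc_self hx))
        (by linarith : 0 ≤ p - 1)
      rw [Real.mul_rpow (Real.rpow_nonneg hx.1.le _) hU.le, ← Real.rpow_mul hx.1.le, hθ] at this
      exact_mod_cast this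
    have h3 : U x ^ (p - 1) ≤ A * x ^ (-2 : ℝ) := by
      rw [hx2, ← div_eq_mul_inv, le_div_iff₀ (pow_pos hx.1 2)]
      linarith
    have h4 : b ^ (p - 1) ≤ A * x ^ (-2 : ℝ) :=
      hbA.trans (le_mul_of_one_le_right hA0.le h1)
    have h5 := abs_rpow_sub_rpow_le hp hU hb h3 h4
    have h6 : (-U x + U x ^ p) - (-b + b ^ p) = (U x ^ p - b ^ p) - (U x - b) := by ring
    rw [h6]
    refine (abs_sub _ _).trans ?_
    have h7 : |U x - b| ≤ x ^ (-2 : ℝ) * |U x - b| := le_mul_of_one_le_left (abs_nonneg _) h1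
    rw [hL]
    linarith
  have hcont : ContinuousOn (fun x : ℝ => x ^ (3 / 2 : ℝ) * |U' x|) (Icc 0 1) :=
    (continuousOn_id.rpow_const fun x hx => Or.inr (by norm_num)).mul h.continuousOn'.abs
  obtain ⟨r₀, hr₀, hmax⟩ := isCompact_Icc.exists_isMaxOn (nonempty_Icc.2 zero_le_one) hcont
  set S := r₀ ^ (3 / 2 : ℝ) * |U' r₀| with hS
  have hS0 : 0 ≤ S := mul_nonneg (Real.rpow_nonneg hr₀.1 _) (abs_nonneg _)
  have hU' : ∀ x ∈ Ioc (0 : ℝ) 1, |U' x| ≤ S * x ^ (-(3 / 2) : ℝ) := by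
    intro x hx
    have h1 : x ^ (3 / 2 : ℝ) * |U' x| ≤ S := hmax (Ioc_subset_Icc_self hx)
    rw [Real.rpow_neg hx.1.le, ← div_eq_mul_inv, le_div_iff₀ (Real.rpow_pos_of_pos hx.1 _)]
    linarith
  have hUb : ∀ x ∈ Ioo (0 : ℝ) 1, |U x - b| ≤ 2 * S * x ^ (-(1 / 2) : ℝ) := by
    intro x hx
    have h1 := abs_sub_le_of_hasDerivAt (g := fun x => -(2 * S) * x ^ (-(1 / 2) : ℝ)) hx.2.le
      (h.continuousOn.mono (Icc_subset_Icc_left hx.1.le))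
      (fun z hz => h.hasDerivAt ⟨hx.1.trans hz.1, hz.2⟩)
      (continuousOn_const.mul (continuousOn_id.rpow_const fun z hz =>
        Or.inl (hx.1.trans_le hz.1).ne'))
      (fun z hz => (Real.hasDerivAt_rpow_const (Or.inl (hx.1.trans hz.1).ne')).const_mul _)
      fun z hz => by
        refine (hU' z ⟨hx.1.trans hz.1, hz.2.le⟩).trans_eq ?_
        norm_num
        ring
    rw [abs_sub_comm] at h1
    simp only [Real.one_rpow] at h1
    linarith
  set c := lam * (-b + b ^ p) / (k + 1) with hc
  have hH : ∀ x ∈ Icc (0 : ℝ) 1,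
      |x ^ k * U' x + c * x ^ (k + 1)| ≤ 4 * lam * L * S * x ^ ((k : ℝ) - 3 / 2) := by
    intro x hx
    have h1 := abs_sub_le_of_hasDerivAt (f := fun x => x ^ k * U' x + c * x ^ (k + 1))
      (f' := fun x => -(lam * x ^ k * (-U x + U x ^ p)) + c * ((k + 1 : ℕ) * x ^ k))
      (g := fun x => 4 * lam * L * S * x ^ ((k : ℝ) - 3 / 2)) hx.1
      ((((continuousOn_pow k).mul h.continuousOn').add
        (continuousOn_const.mul (continuousOn_pow (k + 1)))).mono (Icc_subset_Icc_right hx.2))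
      (fun z hz => (h.hasDerivAt_flux ⟨hz.1, hz.2.trans_le hx.2⟩).add
        ((hasDerivAt_pow (k + 1) z).const_mul c))
      (continuousOn_const.mul (continuousOn_id.rpow_const fun z hz =>
        Or.inr (by linarith)))
      (fun z hz => (Real.hasDerivAt_rpow_const (Or.inl hz.1.ne')).const_mul _)
      fun z hz => by
        have hz1 : z ∈ Ioo (0 : ℝ) 1 := ⟨hz.1, hz.2.trans_le hx.2⟩
        have e1 : -(lam * z ^ k * (-U z + U z ^ p)) + c * ((k + 1 : ℕ) * z ^ k)
            = -(lam * z ^ k * ((-U z + U z ^ p) - (-b + b ^ p))) := by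
          rw [hc]
          push_cast
          field_simp
          ring
        have hzk : 0 ≤ lam * z ^ k := mul_nonneg hlam.le (pow_nonneg hz.1.le _)
        have e2 : z ^ k * z ^ (-2 : ℝ) * z ^ (-(1 / 2) : ℝ) = z ^ ((k : ℝ) - 3 / 2 - 1) := by
          rw [← Real.rpow_natCast, ← Real.rpow_add hz.1, ← Real.rpow_add hz.1]
          congr 1
          ring
        have e3 : |U z - b| ≤ 2 * S * z ^ (-(1 / 2) : ℝ) := hUb z hz1
        have hz2 : 0 ≤ z ^ (-2 : ℝ) := Real.rpow_nonneg hz.1.le _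
        have hz3 : 0 ≤ z ^ ((k : ℝ) - 3 / 2 - 1) := Real.rpow_nonneg hz.1.le _
        rw [e1, abs_neg, abs_mul, abs_of_nonneg hzk]
        calc lam * z ^ k * |(-U z + U z ^ p) - (-b + b ^ p)|
            ≤ lam * z ^ k * (L * z ^ (-2 : ℝ) * (2 * S * z ^ (-(1 / 2) : ℝ))) := by
              refine mul_le_mul_of_nonneg_left ((hlip z hz1).trans ?_) hzk
              gcongr
          _ = 4 * lam * L * S * (1 / 2 * (z ^ k * z ^ (-2 : ℝ) * z ^ (-(1 / 2) : ℝ))) := by ring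
          _ ≤ 4 * lam * L * S * (((k : ℝ) - 3 / 2) * z ^ ((k : ℝ) - 3 / 2 - 1)) := by
              rw [e2]
              gcongr
              linarith
    have hk0 : k ≠ 0 := by omega
    have hk1 : (k : ℝ) - 3 / 2 ≠ 0 := by linarith
    simpa [hk0, Real.zero_rpow hk1] using h1
  have hSS : S ≤ 8 * lam * L * S := by
    rcases hr₀.1.eq_or_lt with h0 | h0
    · rw [hS, ← h0, h.deriv_zero]
      simp
    have h1 := hH 1 (right_mem_Icc.2 zero_le_one)
    rw [h.deriv_one, mul_zero, zero_add, one_pow, mul_one, Real.one_rpow, mul_one] at h1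
    have h2 := hH r₀ hr₀
    set T := 4 * lam * L * S with hT
    have hT0 : 0 ≤ T := by positivity
    have hrk : 0 < r₀ ^ k := pow_pos h0 k
    have h3 : r₀ ^ k * |U' r₀| ≤ T * r₀ ^ ((k : ℝ) - 3 / 2) + T * r₀ ^ (k + 1) := by
      have e1 : |r₀ ^ k * U' r₀| ≤
          |r₀ ^ k * U' r₀ + c * r₀ ^ (k + 1)| + |c * r₀ ^ (k + 1)| := by
        have := abs_sub (r₀ ^ k * U' r₀ + c * r₀ ^ (k + 1)) (c * r₀ ^ (k + 1))
        rwa [add_sub_cancel_right] at this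
      rw [abs_mul, abs_of_pos hrk, abs_mul c, abs_of_pos (pow_pos h0 (k + 1))] at e1
      have e2 : |c| * r₀ ^ (k + 1) ≤ T * r₀ ^ (k + 1) := by gcongr
      linarith
    have h4 : r₀ ^ (k + 1) ≤ r₀ ^ ((k : ℝ) - 3 / 2) := by
      rw [← Real.rpow_natCast]
      refine Real.rpow_le_rpow_of_exponent_ge h0 hr₀.2 ?_
      push_cast
      linarith
    have h5 : r₀ ^ ((k : ℝ) - 3 / 2) * r₀ ^ (3 / 2 : ℝ) = r₀ ^ k := by
      rw [← Real.rpow_add h0, sub_add_cancel, Real.rpow_natCast]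
    have h6 : r₀ ^ k * |U' r₀| ≤ 2 * T * r₀ ^ ((k : ℝ) - 3 / 2) := by
      nlinarith [mul_le_mul_of_nonneg_left h4 hT0]
    have h7 : r₀ ^ k * S ≤ r₀ ^ k * (8 * lam * L * S) := by
      have := mul_le_mul_of_nonneg_right h6 (Real.rpow_nonneg h0.le (3 / 2))
      calc r₀ ^ k * S = r₀ ^ k * |U' r₀| * r₀ ^ (3 / 2 : ℝ) := by rw [hS]; ring
        _ ≤ _ := this
        _ = 2 * T * (r₀ ^ ((k : ℝ) - 3 / 2) * r₀ ^ (3 / 2 : ℝ)) := by ring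
        _ = _ := by rw [h5, hT]; ring
    exact le_of_mul_le_mul_left h7 hrk
  have hS_eq : S = 0 := by nlinarith
  have hfin := abs_sub_le_of_hasDerivAt (g := fun _ => 0) (g' := fun _ => 0) hr.1
    (h.continuousOn.mono (Icc_subset_Icc_right hr.2))
    (fun z hz => h.hasDerivAt ⟨hz.1, hz.2.trans_le hr.2⟩) continuousOn_const
    (fun z hz => hasDerivAt_const z 0) fun z hz => by
      have := hU' z ⟨hz.1, hz.2.le.trans hr.2⟩
      rwa [hS_eq, zero_mul] at this
  rw [sub_zero] at hfin
  exact sub_eq_zero.1 (abs_nonpos_iff.1 hfin)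

theorem strictAntiOn (h : NeumannSol N p lam U U' U'') (hneg : ∀ r ∈ Ioo (0 : ℝ) 1, U' r < 0) :
    StrictAntiOn U (Icc 0 1) := by
  refine strictAntiOn_of_deriv_neg (convex_Icc 0 1) h.continuousOn fun x hx => ?_
  rw [interior_Icc] at hx
  rw [(h.hasDerivAt hx).deriv]
  exact hneg x hx

theorem half_lt_mul_boundary (h : NeumannSol (k + 1) p lam U U' U'') (hk : 2 ≤ k) (hp : 1 < p)
    (hlam : 0 < lam) (hS : (k + 1 : ℝ) / (p + 1) < (k - 1) / 2)
    (hneg : ∀ r ∈ Ioo (0 : ℝ) 1, U' r < 0) :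
    U (1 / 2) < (k + 1) * 2 ^ (k + 1) * U 1 := by
  have hb := h.pos (right_mem_Icc.2 (zero_le_one' ℝ))
  have hanti := h.strictAntiOn hneg
  by_contra! hcon
  set K : ℝ := (k + 1) * 2 ^ (k + 1) with hK
  have hK1 : 1 ≤ K := by
    have e1 : (1 : ℝ) ≤ 2 ^ (k + 1) := one_le_pow₀ one_le_two
    have e2 : (0 : ℝ) ≤ k := k.cast_nonneg
    nlinarith
  set b := U 1 with hb_def
  have hmono : pohozaev k p lam U U' 1 ≤ pohozaev k p lam U U' (1 / 2) := by
    refine le_of_hasDerivAt_nonpos (by norm_num)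
      ((h.continuousOn_pohozaev hp).mono (Icc_subset_Icc_left (by norm_num)))
      (fun x hx => h.hasDerivAt_pohozaev hp ⟨by linarith [hx.1], hx.2⟩) fun x hx => ?_
    have h1 : (0 : ℝ) ≤ (k - 1) / 2 - (k + 1) / (p + 1) := by linarith
    have h2 : (0 : ℝ) ≤ (k + 1) / 2 - (k + 1) / (p + 1) := by linarith
    have : 0 ≤ x := by linarith [hx.1]
    rw [neg_nonpos]
    positivity
  have hhalf := le_of_hasDerivAt_nonpos (a := 0) (b := 1 / 2)
    (f := fun x => pohozaev k p lam U U' x + lam * (K * b) ^ 2 / (k + 1) * x ^ (k + 1))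
    (by norm_num)
    (((h.continuousOn_pohozaev hp).add (continuousOn_const.mul (continuousOn_pow (k + 1)))).mono
      (Icc_subset_Icc_right (by norm_num)))
    (fun x hx => (h.hasDerivAt_pohozaev hp ⟨hx.1, by linarith [hx.2]⟩).add
      ((hasDerivAt_pow (k + 1) x).const_mul _)) fun x hx => by
      have hx0 := hx.1
      have h1 : (0 : ℝ) ≤ (k - 1) / 2 - (k + 1) / (p + 1) := by linarith
      have h2 : (1 : ℝ) ≤ (k + 1) / 2 - (k + 1) / (p + 1) := by linarith
      have h3 : K * b ≤ U x := hcon.trans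
        (hanti ⟨hx.1.le, by linarith [hx.2]⟩ ⟨by norm_num, by norm_num⟩ hx.2).le
      have h4 : (K * b) ^ 2 ≤ U x ^ 2 := by gcongr
      have h5 : lam * (K * b) ^ 2 / (k + 1) * ((k + 1 : ℕ) * x ^ (k + 1 - 1))
          = x ^ k * (lam * (K * b) ^ 2) := by
        rw [Nat.add_sub_cancel]
        push_cast
        field_simp
      have h6 : lam * (K * b) ^ 2 ≤
          lam * ((k + 1) / 2 - (k + 1) / (p + 1)) * U x ^ 2 := by
        calc lam * (K * b) ^ 2 = lam * 1 * (K * b) ^ 2 := by ring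
          _ ≤ _ := by gcongr
      have h7 : 0 ≤ ((k - 1) / 2 - (k + 1) / (p + 1)) * U' x ^ 2 := by positivity
      have hxk := pow_pos hx0 k
      rw [h5]
      have := mul_le_mul_of_nonneg_left (add_le_add h7 h6) hxk.le
      rw [zero_add] at this
      linarith
  simp only [pohozaev_zero (by omega : 1 ≤ k)] at hhalf
  rw [zero_pow (by omega), mul_zero, add_zero, one_div, inv_pow] at hhalf
  rw [h.pohozaev_one, one_div] at hmono
  have hp1 : 0 < p + 1 := by linarith
  have h1 : 0 ≤ lam * (b ^ (p + 1) / (p + 1)) := by positivity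
  have h2 : lam * (K * b) ^ 2 / (k + 1) * ((2 : ℝ) ^ (k + 1))⁻¹ = lam * b ^ 2 * K := by
    rw [hK]
    field_simp
  have h3 : lam * b ^ 2 * 1 ≤ lam * b ^ 2 * K := by gcongr
  have h4 : 0 < lam * b ^ 2 := by positivity
  rw [h2] at hhalf
  linarith

theorem half_lt_rpow_boundary (h : NeumannSol (k + 1) p lam U U' U'') (hp : 1 < p)
    (hlam : 0 < lam) (hneg : ∀ r ∈ Ioo (0 : ℝ) 1, U' r < 0) {K : ℝ}
    (hhalf : U (1 / 2) < K * U 1) (hlarge : K * 2 ^ k * 16 ≤ lam) :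
    1 / 2 < (K * U 1) ^ (p - 1) := by
  have hb := h.pos (right_mem_Icc.2 (zero_le_one' ℝ))
  have hanti := h.strictAntiOn hneg
  by_contra! hcon
  set b := U 1 with hb_def
  set g := lam * (1 / 2) ^ k * b / 2 with hg
  have hg0 : 0 < g := by positivity
  have hflux : ∀ r ∈ Ioo (1 / 2 : ℝ) 1, r ^ k * U' r ≤ -(g * (1 - r)) := by
    intro r hr
    have hr0 : 0 < r := by linarith [hr.1]
    have h1 := le_of_hasDerivAt_nonpos (f := fun x => g * x - x ^ k * U' x) hr.2.le
      (((continuousOn_const.mul continuousOn_id).sub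
        ((continuousOn_pow k).mul h.continuousOn')).mono (Icc_subset_Icc_left hr0.le))
      (fun x hx => ((hasDerivAt_id x).const_mul g).sub
        (h.hasDerivAt_flux ⟨hr0.trans hx.1, hx.2⟩)) fun x hx => by
        have hx0 : 0 < x := hr0.trans hx.1
        have hx2 : 1 / 2 < x := hr.1.trans hx.1
        have hxI : x ∈ Icc (0 : ℝ) 1 := ⟨hx0.le, hx.2.le⟩
        have hU := h.pos hxI
        have e1 : U x < K * b :=
          (hanti ⟨by norm_num, by norm_num⟩ hxI hx2).trans hhalf
        have e2 : b ≤ U x := (hanti hxI (right_mem_Icc.2 zero_le_one) hx.2).le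
        have e3 : U x ^ (p - 1) ≤ 1 / 2 :=
          (Real.rpow_le_rpow hU.le e1.le (by linarith)).trans hcon
        have e4 : U x ^ p = U x ^ (p - 1) * U x := by
          rw [← Real.rpow_add_one hU.ne', sub_add_cancel]
        have e5 : b / 2 ≤ U x - U x ^ p := by
          rw [e4]
          nlinarith
        have e6 : lam * (1 / 2) ^ k * (b / 2) ≤ lam * x ^ k * (U x - U x ^ p) := by gcongr
        rw [hg]
        linarith
    rw [h.deriv_one] at h1
    linarith
  have h1 := le_of_hasDerivAt_nonpos (f := fun x => U x - g / 2 * (1 - x) ^ 2)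
    (a := 1 / 2) (b := 1) (by norm_num)
    ((h.continuousOn.mono (Icc_subset_Icc_left (by norm_num))).sub (by fun_prop))
    (fun x hx => (h.hasDerivAt ⟨by linarith [hx.1], hx.2⟩).sub
      ((((hasDerivAt_id x).const_sub 1).pow 2).const_mul (g / 2))) fun x hx => by
      have hx0 : 0 < x := by linarith [hx.1]
      have e1 := hflux x hx
      have e2 : x ^ k ≤ 1 := pow_le_one₀ hx0.le hx.2.le
      have e3 := hneg x ⟨hx0, hx.2⟩
      simp only [id]
      norm_num
      nlinarith
  norm_num at h1
  rw [← hb_def] at h1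
  norm_num at hhalf
  have h2 : g = lam * b / (2 * 2 ^ k) := by
    rw [hg, one_div, inv_pow]
    field_simp
  have h3 : K * 2 ^ k * 16 * b / (2 * 2 ^ k) ≤ g := by
    rw [h2]
    gcongr
  have h4 : K * 2 ^ k * 16 * b / (2 * 2 ^ k) = 8 * (K * b) := by
    field_simp
    ring
  linarith

theorem half_lt_one_of_linear_bound (h : NeumannSol (k + 1) p lam U U' U'') (hlam : 0 < lam)
    (hneg : ∀ r ∈ Ioo (0 : ℝ) 1, U' r < 0) {c : ℝ} (hc : 0 < c)
    (hlin : ∀ r ∈ Icc (0 : ℝ) 1, 1 ≤ U r → c * (U r - 1) ≤ -U r + U r ^ p)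
    (hlarge : 128 * (k + 1) ^ 2 ≤ lam * c) : U (1 / 2) < 1 := by
  by_contra! hcon
  have hanti := h.strictAntiOn hneg
  have hgt : ∀ r ∈ Ico (0 : ℝ) (1 / 2), 1 < U r := fun r hr => hcon.trans_lt
    (hanti ⟨hr.1, by linarith [hr.2]⟩ ⟨by norm_num, by norm_num⟩ hr.2)
  have hk0 : (0 : ℝ) ≤ k := k.cast_nonneg
  have hslope : ∀ r ∈ Icc (1 / 4 : ℝ) (7 / 16), 32 * (k + 1) * (U r - 1) ≤ -U' r := by
    intro r hr
    have hr0 : 0 < r := by linarith [hr.1]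
    have hr1 : r < 1 / 2 := by linarith [hr.2]
    have hw : 0 < U r - 1 := sub_pos.2 (hgt r ⟨hr0.le, hr1⟩)
    have h1 := le_of_hasDerivAt_nonpos
      (f := fun x => x ^ k * U' x + lam * c * (U r - 1) / (k + 1) * x ^ (k + 1)) hr0.le
      ((((continuousOn_pow k).mul h.continuousOn').add
        (continuousOn_const.mul (continuousOn_pow (k + 1)))).mono
          (Icc_subset_Icc_right (by linarith)))
      (fun x hx => (h.hasDerivAt_flux ⟨hx.1, by linarith [hx.2]⟩).add
        ((hasDerivAt_pow (k + 1) x).const_mul _)) fun x hx => by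
        have hxI : x ∈ Icc (0 : ℝ) 1 := ⟨hx.1.le, by linarith [hx.2]⟩
        have e1 : U r ≤ U x := (hanti hxI ⟨hr0.le, by linarith⟩ hx.2).le
        have e2 := hlin x hxI (by linarith)
        have hx0 := hx.1
        have e3 : c * (U r - 1) ≤ -U x + U x ^ p := by
          refine le_trans ?_ e2
          gcongr
        have e4 : lam * c * (U r - 1) / (k + 1) * ((k + 1 : ℕ) * x ^ (k + 1 - 1))
            = lam * x ^ k * (c * (U r - 1)) := by
          rw [Nat.add_sub_cancel]
          push_cast
          field_simp
        have e5 : lam * x ^ k * (c * (U r - 1)) ≤ lam * x ^ k * (-U x + U x ^ p) := by gcongr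
        rw [e4]
        linarith
    rw [h.deriv_zero, mul_zero, zero_pow (by omega), mul_zero, add_zero, pow_succ] at h1
    have h2 : r ^ k * (U' r + lam * c * (U r - 1) / (k + 1) * r) ≤ r ^ k * 0 := by linarith
    have h3 := le_of_mul_le_mul_left h2 (pow_pos hr0 k)
    have h4 : 128 * (k + 1) ^ 2 * (U r - 1) / (k + 1) * (1 / 4) ≤
        lam * c * (U r - 1) / (k + 1) * r := by
      have := hr.1
      gcongr
    have h5 : 128 * ((k : ℝ) + 1) ^ 2 * (U r - 1) / (k + 1) * (1 / 4)
        = 32 * (k + 1) * (U r - 1) := by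
      field_simp
      norm_num
    linarith
  have hsub : Icc (1 / 4 : ℝ) (7 / 16) ⊆ Icc 0 1 := Icc_subset_Icc (by norm_num) (by norm_num)
  have h1 := le_of_hasDerivAt_nonpos (f := fun x => (U x - 1) / -U' x + 1 / 2 * x)
    (a := 1 / 4) (b := 7 / 16) (by norm_num)
    ((((h.continuousOn.mono hsub).sub continuousOn_const).div (h.continuousOn'.mono hsub).neg
      fun x hx => (neg_pos.2 (hneg x ⟨by linarith [hx.1], by linarith [hx.2]⟩)).ne').add
      (by fun_prop))
    (fun x hx => by
      have hxI : x ∈ Ioo (0 : ℝ) 1 := ⟨by linarith [hx.1], by linarith [hx.2]⟩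
      exact (((h.hasDerivAt hxI).sub_const 1).div (h.hasDerivAt' hxI).neg
        (neg_pos.2 (hneg x hxI)).ne').add ((hasDerivAt_id x).const_mul (1 / 2)))
    fun x hx => by
      have hxI : x ∈ Ioo (0 : ℝ) 1 := ⟨by linarith [hx.1], by linarith [hx.2]⟩
      have e1 := hslope x (Ioo_subset_Icc_self hx)
      have e2 := hneg x hxI
      have e3 := hgt x ⟨hxI.1.le, by linarith [hx.2]⟩
      have e4 := hlin x (Ioo_subset_Icc_self hxI) e3.le
      have e5 : U'' x ≤ 4 * k * -U' x := by
        rw [h.second_deriv_eq hxI]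
        have e6 : 0 ≤ lam * (-U x + U x ^ p) :=
          mul_nonneg hlam.le ((mul_pos hc (sub_pos.2 e3)).le.trans e4)
        have e7 : k / x ≤ 4 * k := by
          rw [div_le_iff₀ hxI.1]
          nlinarith [hx.1]
        nlinarith
      have e6 : (U x - 1) * U'' x ≤ U' x ^ 2 / 2 := by
        have f1 : (U x - 1) * U'' x ≤ (U x - 1) * (4 * k * -U' x) :=
          mul_le_mul_of_nonneg_left e5 (by linarith)
        have f2 : 4 * k * (U x - 1) ≤ -U' x / 2 := by nlinarith
        nlinarith
      simp only [Pi.neg_apply]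
      have hU'2 : 0 < (-U' x) ^ 2 := by
        have := neg_pos.2 e2
        positivity
      have e7 : (U' x * -U' x - (U x - 1) * -U'' x) / (-U' x) ^ 2 ≤ -(1 / 2) := by
        rw [div_le_iff₀ hU'2]
        linarith
      linarith
  have h2 : 0 < (U (7 / 16) - 1) / -U' (7 / 16) :=
    div_pos (sub_pos.2 (hgt _ ⟨by norm_num, by norm_num⟩))
      (neg_pos.2 (hneg _ ⟨by norm_num, by norm_num⟩))
  have h3 : (U (1 / 4) - 1) / -U' (1 / 4) ≤ 1 / 32 := by
    rw [div_le_iff₀ (neg_pos.2 (hneg _ ⟨by norm_num, by norm_num⟩))]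
    have e1 := hslope (1 / 4) ⟨by norm_num, by norm_num⟩
    have e2 := hgt (1 / 4) ⟨by norm_num, by norm_num⟩
    nlinarith
  linarith

theorem one_le_half_of_linear_bound (h : NeumannSol (k + 1) p lam U U' U'') (hlam : 0 < lam)
    (hneg : ∀ r ∈ Ioo (0 : ℝ) 1, U' r < 0) {c : ℝ}
    (hlin : ∀ r ∈ Icc (0 : ℝ) 1, U r ≤ 1 → -U r + U r ^ p ≤ -(c * (1 - U r)))
    (hlarge : 16 ≤ lam * c) : 1 ≤ U (1 / 2) := by
  by_contra! hcon
  have hanti := h.strictAntiOn hneg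
  have hpos : ∀ r ∈ Icc (1 / 2 : ℝ) 1, 0 < 1 - U r := by
    intro r hr
    have := hanti.antitoneOn (⟨by norm_num, by norm_num⟩ : (1 / 2 : ℝ) ∈ Icc (0 : ℝ) 1)
      ⟨by linarith [hr.1], hr.2⟩ hr.1
    linarith
  set q : ℝ → ℝ := fun x => -U' x / (1 - U x) with hq
  set q' : ℝ → ℝ := fun x => (-U'' x * (1 - U x) - -U' x * -U' x) / (1 - U x) ^ 2 with hq'
  have hqc : ContinuousOn q (Icc (1 / 2) 1) := by
    have hsub : Icc (1 / 2 : ℝ) 1 ⊆ Icc 0 1 := Icc_subset_Icc_left (by norm_num)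
    exact (h.continuousOn'.mono hsub).neg.div
      (continuousOn_const.sub (h.continuousOn.mono hsub)) fun x hx => (hpos x hx).ne'
  have hqd : ∀ x ∈ Ioo (1 / 2 : ℝ) 1, HasDerivAt q (q' x) x := by
    intro x hx
    have hxI : x ∈ Ioo (0 : ℝ) 1 := ⟨by linarith [hx.1], hx.2⟩
    exact (h.hasDerivAt' hxI).neg.div ((h.hasDerivAt hxI).const_sub 1)
      (hpos x (Ioo_subset_Icc_self hx)).ne'
  have hqle : ∀ x ∈ Ioo (1 / 2 : ℝ) 1, q' x ≤ -(lam * c) - q x ^ 2 := by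
    intro x hx
    have hxI : x ∈ Ioo (0 : ℝ) 1 := ⟨by linarith [hx.1], hx.2⟩
    have hz := hpos x (Ioo_subset_Icc_self hx)
    have e1 := hlin x (Ioo_subset_Icc_self hxI) (by linarith)
    have e2 : -U'' x ≤ -(lam * c * (1 - U x)) := by
      rw [h.second_deriv_eq hxI]
      have f1 : k / x * U' x ≤ 0 :=
        mul_nonpos_of_nonneg_of_nonpos (div_nonneg k.cast_nonneg hxI.1.le) (hneg x hxI).le
      have f2 := mul_le_mul_of_nonneg_left e1 hlam.le
      linarith
    have e3 : -(lam * c) - q x ^ 2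
        = (-(lam * c * (1 - U x)) * (1 - U x) - -U' x * -U' x) / (1 - U x) ^ 2 := by
      rw [hq]
      field_simp
    rw [e3]
    refine div_le_div_of_nonneg_right ?_ (by positivity)
    linarith [mul_le_mul_of_nonneg_right e2 hz.le]
  have hlow : ∀ x ∈ Icc (1 / 2 : ℝ) (3 / 4), lam * c / 4 ≤ q x := by
    intro x hx
    have hx1 : x ≤ 1 := by linarith [hx.2]
    have h1 := le_of_hasDerivAt_nonpos (f := fun y => q y + lam * c * y) hx1
      ((hqc.mono (Icc_subset_Icc_left hx.1)).add (by fun_prop))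
      (fun y hy => (hqd y ⟨hx.1.trans_lt hy.1, hy.2⟩).add ((hasDerivAt_id y).const_mul _))
      fun y hy => by
        have := hqle y ⟨hx.1.trans_lt hy.1, hy.2⟩
        nlinarith [sq_nonneg (q y)]
    have h2 : q 1 = 0 := by simp [hq, h.deriv_one]
    simp only [h2] at h1
    nlinarith [hx.2]
  have hq0 : ∀ x ∈ Icc (1 / 2 : ℝ) (3 / 4), 0 < q x := fun x hx => by linarith [hlow x hx]
  have h1 := le_of_hasDerivAt_nonpos (f := fun y => y - (q y)⁻¹) (a := 1 / 2) (b := 3 / 4)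
    (by norm_num)
    (continuousOn_id.sub ((hqc.mono (Icc_subset_Icc_right (by norm_num))).inv₀
      fun x hx => (hq0 x hx).ne'))
    (fun y hy => (hasDerivAt_id y).sub
      ((hqd y ⟨hy.1, by linarith [hy.2]⟩).inv (hq0 y (Ioo_subset_Icc_self hy)).ne'))
    fun y hy => by
      have e1 := hqle y ⟨hy.1, by linarith [hy.2]⟩
      have e2 := hq0 y (Ioo_subset_Icc_self hy)
      have e3 : 1 ≤ -q' y / q y ^ 2 := by
        rw [le_div_iff₀ (by positivity)]
        linarith
      linarith
  have h2 := inv_pos.2 (hq0 (1 / 2) ⟨le_rfl, by norm_num⟩)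
  have h3 : (q (3 / 4))⁻¹ ≤ (4 : ℝ)⁻¹ :=
    inv_anti₀ (by norm_num) (by linarith [hlow (3 / 4) ⟨by norm_num, le_rfl⟩])
  linarith

end NeumannSol

/-- Corollary 1: for `p > p_S` there is `λ̲ > 0` such that the Neumann
problem has no nonconstant solution for `0 < λ < λ̲`, and there is `λ̄ > 0` such that
no radially decreasing solution exists for `λ > λ̄`. -/
theorem no_nonconstant_solution_small_lambda (N : ℕ) (hN : 3 ≤ N) (p : ℝ)
    (hp : 1 < p) (hpS : pSob N < p) :
    (∃ lam₀ > (0:ℝ), ∀ lam : ℝ, 0 < lam → lam < lam₀ →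
      ∀ U U' U'' : ℝ → ℝ, NeumannSol N p lam U U' U'' →
        ∀ r ∈ Icc (0:ℝ) 1, U r = U 0) ∧
    (∃ lam₁ > (0:ℝ), ∀ lam : ℝ, lam₁ < lam →
      ∀ U U' U'' : ℝ → ℝ, NeumannSol N p lam U U' U'' →
        ¬ (∀ r ∈ Ioo (0:ℝ) 1, U' r < 0)) := by
  obtain ⟨k, rfl⟩ : ∃ k, N = k + 1 := ⟨N - 1, by omega⟩
  have hk : 2 ≤ k := by omega
  have hk' : (2 : ℝ) ≤ k := by exact_mod_cast hk
  have hp0 : 0 < p - 1 := by linarith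
  have hp1 : 0 < p + 1 := by linarith
  have hsup : (k : ℝ) + 3 < p * (k - 1) := by
    rw [pSob, div_lt_iff₀ (by push_cast; linarith)] at hpS
    push_cast at hpS
    linarith
  have hS : (k + 1 : ℝ) / (p + 1) < (k - 1) / 2 := by
    rw [div_lt_div_iff₀ hp1 two_pos]
    linarith
  constructor
  · obtain ⟨θ, hθ⟩ : ∃ θ : ℝ, θ * (p - 1) = 2 := ⟨2 / (p - 1), div_mul_cancel₀ 2 hp0.ne'⟩
    have hθ0 : 0 < θ := pos_of_mul_pos_left (by rw [hθ]; norm_num) hp0.le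
    obtain ⟨α, hα⟩ : ∃ α : ℝ, α = k - 1 - 2 * θ := ⟨_, rfl⟩
    have hα0 : 0 < α := by
      refine pos_of_mul_pos_left (b := p - 1) ?_ hp0.le
      rw [hα, sub_mul, mul_assoc, hθ]
      linarith
    obtain ⟨B, hB⟩ : ∃ B : ℝ, B = θ * (k - 1 - θ) := ⟨_, rfl⟩
    have hB0 : 0 < B := by
      rw [hB]
      exact mul_pos hθ0 (by linarith)
    obtain ⟨σ, hσ0, hσ⟩ : ∃ σ : ℝ, 0 < σ ∧ σ ^ 2 = B / 2 :=
      ⟨√(B / 2), Real.sqrt_pos.2 (by positivity), Real.sq_sqrt (by positivity)⟩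
    obtain ⟨K, hK, hK1, hK2⟩ : ∃ K : ℝ, 0 < K ∧ 4 * (B + 1) ≤ B * K ^ 2 ∧
        B + 1 < 3 * α * σ * K ^ 2 := by
      have hsq : Tendsto (fun K : ℝ => K ^ 2) atTop atTop := tendsto_pow_atTop two_ne_zero
      exact ((eventually_gt_atTop 0).and (((hsq.const_mul_atTop hB0).eventually_ge_atTop _).and
        ((hsq.const_mul_atTop (by positivity)).eventually_gt_atTop _))).exists
    set b₀ : ℝ := ((p + 1) / 2) ^ (1 / (p - 1)) with hb₀
    have hb₀0 : 0 < b₀ := Real.rpow_pos_of_pos (by positivity) _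
    set A : ℝ := (2 * K * b₀) ^ (p - 1) with hA
    have hA0 : 0 < A := Real.rpow_pos_of_pos (by positivity) _
    refine ⟨min 1 (min (B / 4 / A) (1 / (8 * (1 + p * A)))),
      lt_min one_pos (lt_min (by positivity) (by positivity)), ?_⟩
    intro lam hlam hlt U U' U'' h r hr
    rw [lt_min_iff, lt_min_iff, lt_div_iff₀ hA0] at hlt
    have hlt' := (lt_div_iff₀ (by positivity)).1 hlt.2.2
    have hb := h.pos (right_mem_Icc.2 (zero_le_one' ℝ))
    have hbb₀ : U 1 ≤ b₀ := by
      have := Real.rpow_le_rpow (Real.rpow_nonneg hb.le _)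
        (h.rpow_boundary_le hk hp hlam hS) (by positivity : 0 ≤ 1 / (p - 1))
      rwa [← Real.rpow_mul hb.le, mul_one_div_cancel hp0.ne', Real.rpow_one] at this
    have hle : 2 * K * U 1 ≤ 2 * K * b₀ := by gcongr
    refine h.eq_of_emden_le hk hp hlam hθ (M := 2 * K * b₀) (fun r hr => ?_)
      (by linarith) hr
    refine (h.emden_le hp hlam hlt.1.le hθ0 hθ hα hα0 hB hσ0 hσ hK hK1 hK2 ?_ hr).trans hle
    refine le_trans ?_ hlt.2.1.le
    have : (2 * K * U 1) ^ (p - 1) ≤ A := Real.rpow_le_rpow (by positivity) hle hp0.le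
    gcongr
  · obtain ⟨K, hK⟩ : ∃ K : ℝ, K = (k + 1) * 2 ^ (k + 1) := ⟨_, rfl⟩
    have hK1 : 1 ≤ K := by
      have e1 : (1 : ℝ) ≤ 2 ^ (k + 1) := one_le_pow₀ one_le_two
      rw [hK]
      nlinarith
    have hd0 : 0 < (1 / 2 : ℝ) ^ (1 / (p - 1)) := Real.rpow_pos_of_pos (by norm_num) _
    have hd1 : (1 / 2 : ℝ) ^ (1 / (p - 1)) < 1 :=
      Real.rpow_lt_one (by norm_num) (by norm_num) (by positivity)
    obtain ⟨c, hc, hlin⟩ := exists_linear_bound_rpow_sub hp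
      (δ := (1 / 2 : ℝ) ^ (1 / (p - 1)) / K) (by positivity)
      ((div_le_self hd0.le hK1).trans_lt hd1)
    refine ⟨max (K * 2 ^ k * 16) (128 * (k + 1) ^ 2 / c), lt_max_of_lt_left (by positivity), ?_⟩
    intro lam hlt U U' U'' h hneg
    rw [max_lt_iff, div_lt_iff₀ hc] at hlt
    have hlam : 0 < lam := lt_of_le_of_lt (by positivity) hlt.1
    have hb := h.pos (right_mem_Icc.2 (zero_le_one' ℝ))
    have hhalf := h.half_lt_mul_boundary hk hp hlam hS hneg
    rw [← hK] at hhalf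
    have hbd := h.half_lt_rpow_boundary hp hlam hneg hhalf hlt.1.le
    have hδb : (1 / 2 : ℝ) ^ (1 / (p - 1)) / K ≤ U 1 := by
      rw [div_le_iff₀ (by linarith), mul_comm]
      have := Real.rpow_le_rpow (by norm_num) hbd.le (by positivity : 0 ≤ 1 / (p - 1))
      rwa [← Real.rpow_mul (by positivity), mul_one_div_cancel hp0.ne', Real.rpow_one] at this
    have hU : ∀ r ∈ Icc (0 : ℝ) 1, (1 / 2 : ℝ) ^ (1 / (p - 1)) / K ≤ U r := fun r hr =>
      hδb.trans ((h.strictAntiOn hneg).antitoneOn hr (right_mem_Icc.2 zero_le_one) hr.2)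
    have h1 := h.half_lt_one_of_linear_bound hlam hneg hc
      (fun r hr => (hlin _ (hU r hr)).1) hlt.2.le
    have h2 := h.one_le_half_of_linear_bound hlam hneg
      (fun r hr => (hlin _ (hU r hr)).2) (by nlinarith [hlt.2])
    linarith
end
end

section
/- Let p > 1. There exists λ₀ > 0 such that for every λ > λ₀ the Neumann problem (N) has a solution U_λ with the property that U_λ(r) − 1 has exactly one zero in [0,1]; moreover this family of solutions concentrates on the boundary as λ → ∞: U_λ(0) → 0, U_λ(1) → ((p+1)/2)^{1/(p−1)}, and for every δ ∈ (0,1), sup_{0 ≤ r ≤ 1−δ} U_λ(r) → 0 as λ → ∞. -/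
open Real Set Filter Topology MeasureTheory

noncomputable section

/-- The mean `∫₀¹ σⁿ h(tσ) dσ`; `t * radMean n h t` is the derivative of the radial solution of
`u'' + (n/t) u' = h`. -/
def radMean (n : ℕ) (h : ℝ → ℝ) (t : ℝ) : ℝ := ∫ σ in (0:ℝ)..1, σ ^ n * h (t * σ)

theorem continuous_radMean_family {X : Type*} [TopologicalSpace X] (n : ℕ) {h : X → ℝ → ℝ}
    (hh : Continuous fun q : X × ℝ => h q.1 q.2) :
    Continuous fun q : X × ℝ => radMean n (h q.1) q.2 := by
  unfold radMean
  apply intervalIntegral.continuous_parametric_intervalIntegral_of_continuous'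
  have : Continuous fun z : (X × ℝ) × ℝ => h z.1.1 (z.1.2 * z.2) :=
    hh.comp (f := fun z : (X × ℝ) × ℝ => (z.1.1, z.1.2 * z.2)) (by fun_prop)
  exact (continuous_snd.pow n).mul this

theorem continuous_radMean (n : ℕ) {h : ℝ → ℝ} (hh : Continuous h) :
    Continuous (radMean n h) :=
  (continuous_radMean_family n (X := Unit) (h := fun _ => h) (by fun_prop)).comp
    (f := fun t : ℝ => ((), t)) (by fun_prop)

theorem radMean_zero (n : ℕ) (h : ℝ → ℝ) : radMean n h 0 = h 0 / (n + 1) := by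
  simp [radMean, integral_pow]
  ring

theorem pow_mul_radMean (n : ℕ) (h : ℝ → ℝ) (t : ℝ) :
    t ^ (n + 1) * radMean n h t = ∫ x in (0:ℝ)..t, x ^ n * h x := by
  have := intervalIntegral.mul_integral_comp_mul_left (a := 0) (b := 1)
    (f := fun x : ℝ => x ^ n * h x) (c := t)
  simp only [mul_zero, mul_one] at this
  rw [← this, radMean, pow_succ', mul_assoc, ← intervalIntegral.integral_const_mul]
  congr 2
  ext x
  ring

theorem hasDerivAt_mul_radMean (n : ℕ) {h : ℝ → ℝ} (hh : Continuous h) (s : ℝ) :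
    HasDerivAt (fun t => t * radMean n h t) (h s - n * radMean n h s) s := by
  rcases eq_or_ne s 0 with rfl | hs
  · have h1 : h 0 - n * radMean n h 0 = radMean n h 0 := by
      rw [radMean_zero]; field_simp; ring
    rw [h1, hasDerivAt_iff_tendsto_slope]
    refine ((continuous_radMean n hh).tendsto 0 |>.mono_left nhdsWithin_le_nhds).congr' ?_
    filter_upwards [self_mem_nhdsWithin] with t ht
    have ht : t ≠ 0 := ht
    simp [slope_def_field]
    field_simp
  · have hI : HasDerivAt (fun t => ∫ x in (0:ℝ)..t, x ^ n * h x) (s ^ n * h s) s :=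
      intervalIntegral.integral_hasDerivAt_right
        ((by fun_prop : Continuous fun x => x ^ n * h x).intervalIntegrable _ _)
        (by fun_prop : Continuous fun x => x ^ n * h x).stronglyMeasurable.stronglyMeasurableAtFilter
        (by fun_prop)
    have h2 := hI.div (hasDerivAt_pow n s) (pow_ne_zero n hs)
    have h3 : (fun t => t * radMean n h t) =ᶠ[𝓝 s]
        ((fun t => ∫ x in (0:ℝ)..t, x ^ n * h x) / fun t => t ^ n) := by
      filter_upwards [isOpen_ne.mem_nhds hs] with t ht
      have ht : t ≠ 0 := ht
      simp only [Pi.div_apply]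
      rw [← pow_mul_radMean]
      field_simp
      ring
    refine (h2.congr_of_eventuallyEq h3).congr_deriv ?_
    rw [← pow_mul_radMean]
    rcases n with _ | n
    · simp
    · push_cast [Nat.add_sub_cancel]
      field_simp
      ring

theorem abs_mul_radMean_le (n : ℕ) {h : ℝ → ℝ} {C L : ℝ} (hL : 0 < L)
    (hC : ∀ x, |h x| ≤ C * exp (L * |x|)) {t : ℝ} (ht : 0 ≤ t) :
    |t * radMean n h t| ≤ C / L * exp (L * t) := by
  have hC0 : 0 ≤ C := by
    have := (abs_nonneg _).trans (hC 0)
    simpa using this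
  have h1 : t * ∫ σ in (0:ℝ)..1, C * exp (L * (t * σ)) = C / L * (exp (L * t) - 1) := by
    rw [← intervalIntegral.integral_const_mul]
    rw [intervalIntegral.integral_eq_sub_of_hasDerivAt (f := fun σ => C / L * exp (L * (t * σ)))]
    · simp; ring
    · intro x _
      have := ((((hasDerivAt_id x).const_mul t).const_mul L).exp).const_mul (C / L)
      refine this.congr_deriv ?_
      simp; field_simp
    · exact (by fun_prop : Continuous _).intervalIntegrable _ _
  have h2 : |radMean n h t| ≤ ∫ σ in (0:ℝ)..1, C * exp (L * (t * σ)) := by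
    unfold radMean
    rw [← Real.norm_eq_abs]
    apply intervalIntegral.norm_integral_le_of_norm_le zero_le_one
    · refine ae_of_all _ fun σ hσ => ?_
      rw [norm_mul, Real.norm_eq_abs, Real.norm_eq_abs, abs_of_nonneg (pow_nonneg hσ.1.le n)]
      have h3 := hC (t * σ)
      rw [abs_of_nonneg (mul_nonneg ht hσ.1.le)] at h3
      calc σ ^ n * |h (t * σ)| ≤ 1 * |h (t * σ)| := by
            gcongr; exact pow_le_one₀ hσ.1.le hσ.2
        _ ≤ _ := by rw [one_mul]; exact h3
    · exact (by fun_prop : Continuous _).intervalIntegrable _ _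
  rw [abs_mul, abs_of_nonneg ht]
  calc t * |radMean n h t| ≤ t * ∫ σ in (0:ℝ)..1, C * exp (L * (t * σ)) := by gcongr
    _ = C / L * (exp (L * t) - 1) := h1
    _ ≤ _ := by
      gcongr; linarith

theorem abs_integral_mul_radMean_le (n : ℕ) {h : ℝ → ℝ} {C L : ℝ} (hL : 0 < L)
    (hC : ∀ x, |h x| ≤ C * exp (L * |x|)) {s : ℝ} (hs : 0 ≤ s) :
    |∫ t in (0:ℝ)..s, t * radMean n h t| ≤ C / L ^ 2 * exp (L * s) := by
  have hC0 : 0 ≤ C := by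
    have := (abs_nonneg _).trans (hC 0)
    simpa using this
  have h1 : ∫ t in (0:ℝ)..s, C / L * exp (L * t) = C / L ^ 2 * (exp (L * s) - 1) := by
    rw [intervalIntegral.integral_eq_sub_of_hasDerivAt (f := fun t => C / L ^ 2 * exp (L * t))]
    · simp; ring
    · intro x _
      have := ((((hasDerivAt_id x).const_mul L)).exp).const_mul (C / L ^ 2)
      refine this.congr_deriv ?_
      simp; field_simp
    · exact (by fun_prop : Continuous _).intervalIntegrable _ _
  rw [← Real.norm_eq_abs]
  refine (intervalIntegral.norm_integral_le_of_norm_le hs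
    (g := fun t => C / L * exp (L * t)) ?_ ?_).trans ?_
  · exact ae_of_all _ fun t ht => abs_mul_radMean_le n hL hC ht.1.le
  · exact (by fun_prop : Continuous _).intervalIntegrable _ _
  · rw [h1]; gcongr; linarith

theorem continuous_weighted {g : ℝ → ℝ} {K : NNReal} {L : ℝ} (v : BoundedContinuousFunction ℝ ℝ)
    (hg : LipschitzWith K g) : Continuous fun x => g (exp (L * |x|) * v x) :=
  hg.continuous.comp (by fun_prop)

open BoundedContinuousFunction in
/-- The Picard operator of the radial initial value problem `u'' + (n/s) u' = g(u)`, `u(0) = γ`,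
conjugated by the weight `exp (L|s|)`. -/
def picardMap (n : ℕ) {g : ℝ → ℝ} {K : NNReal} (hg : LipschitzWith K g) (hg0 : g 0 = 0)
    {L : ℝ} (hL : 0 < L) (γ : ℝ) (v : ℝ →ᵇ ℝ) : ℝ →ᵇ ℝ :=
  BoundedContinuousFunction.ofNormedAddCommGroup
    (fun s => exp (-(L * |s|)) *
      (γ + ∫ t in (0:ℝ)..|s|, t * radMean n (fun x => g (exp (L * |x|) * v x)) t))
    (by
      have hc := continuous_weighted (L := L) v hg
      have h1 : Continuous fun s : ℝ =>
          ∫ t in (0:ℝ)..s, t * radMean n (fun x => g (exp (L * |x|) * v x)) t :=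
        intervalIntegral.continuous_primitive
          (fun a b => (continuous_id.mul (continuous_radMean n hc)).intervalIntegrable a b) 0
      have h2 := h1.comp continuous_abs
      fun_prop)
    (|γ| + K * ‖v‖ / L ^ 2)
    (by
      intro s
      have h1 := abs_integral_mul_radMean_le n (C := K * ‖v‖) hL (fun x => by
        have := hg.dist_le_mul (exp (L * |x|) * v x) 0
        rw [hg0, dist_zero_right, dist_zero_right, norm_mul] at this
        have h3 := v.norm_coe_le_norm x
        rw [Real.norm_eq_abs, Real.norm_eq_abs, abs_of_pos (exp_pos _)] at this
        calc _ ≤ _ := this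
          _ ≤ K * (exp (L * |x|) * ‖v‖) := by gcongr
          _ = _ := by ring) (abs_nonneg s)
      rw [norm_mul, Real.norm_eq_abs, abs_of_pos (exp_pos _)]
      have h4 : exp (-(L * |s|)) ≤ 1 := by
        rw [exp_le_one_iff]; have := abs_nonneg s; nlinarith
      have h5 : exp (-(L * |s|)) * exp (L * |s|) = 1 := by rw [← exp_add]; simp
      calc _ ≤ exp (-(L * |s|)) * (|γ| + K * ‖v‖ / L ^ 2 * exp (L * |s|)) := by
            gcongr
            exact (norm_add_le _ _).trans (by gcongr; exacts [le_rfl, h1])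
        _ = exp (-(L * |s|)) * |γ| + K * ‖v‖ / L ^ 2 * (exp (-(L * |s|)) * exp (L * |s|)) := by ring
        _ ≤ 1 * |γ| + K * ‖v‖ / L ^ 2 * 1 := by rw [h5]; gcongr
        _ = _ := by ring)

section Picard

variable {n : ℕ} {g : ℝ → ℝ} {K : NNReal} (hg : LipschitzWith K g) (hg0 : g 0 = 0)

theorem picardMap_apply {L : ℝ} (hL : 0 < L) (γ : ℝ) (v : BoundedContinuousFunction ℝ ℝ) (s : ℝ) :
    picardMap n hg hg0 hL γ v s = exp (-(L * |s|)) *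
      (γ + ∫ t in (0:ℝ)..|s|, t * radMean n (fun x => g (exp (L * |x|) * v x)) t) := rfl

theorem dist_picardMap_initial {L : ℝ} (hL : 0 < L) (γ γ' : ℝ)
    (v : BoundedContinuousFunction ℝ ℝ) :
    dist (picardMap n hg hg0 hL γ v) (picardMap n hg hg0 hL γ' v) ≤ |γ - γ'| := by
  rw [BoundedContinuousFunction.dist_le (abs_nonneg _)]
  intro s
  rw [picardMap_apply, picardMap_apply, Real.dist_eq, ← mul_sub, add_sub_add_right_eq_sub, abs_mul,
    abs_of_pos (exp_pos _)]
  have h4 : exp (-(L * |s|)) ≤ 1 := by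
    rw [exp_le_one_iff]; have := abs_nonneg s; nlinarith
  exact mul_le_of_le_one_left (abs_nonneg _) h4

theorem radMean_sub {h₁ h₂ : ℝ → ℝ} (c₁ : Continuous h₁) (c₂ : Continuous h₂) (t : ℝ) :
    radMean n (fun x => h₁ x - h₂ x) t = radMean n h₁ t - radMean n h₂ t := by
  unfold radMean
  rw [← intervalIntegral.integral_sub]
  · congr 1; ext σ; ring
  · exact (by fun_prop : Continuous fun σ => σ ^ n * h₁ (t * σ)).intervalIntegrable _ _
  · exact (by fun_prop : Continuous fun σ => σ ^ n * h₂ (t * σ)).intervalIntegrable _ _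

theorem contractingWith_picardMap (γ : ℝ) :
    ContractingWith (1 / 4) (picardMap n hg hg0 (L := K + 1) (by positivity) γ) := by
  refine ⟨by rw [← NNReal.coe_lt_coe]; push_cast; norm_num, ?_⟩
  apply LipschitzWith.of_dist_le_mul
  intro v w
  have hL : (0:ℝ) < K + 1 := by positivity
  rw [BoundedContinuousFunction.dist_le (by positivity)]
  intro s
  set L : ℝ := K + 1
  have hv := continuous_weighted (L := L) v hg
  have hw := continuous_weighted (L := L) w hg
  have hI : ∀ {k : ℝ → ℝ}, Continuous k →
      IntervalIntegrable (fun t => t * radMean n k t) volume 0 |s| := fun hk =>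
    (continuous_id.mul (continuous_radMean n hk)).intervalIntegrable _ _
  rw [picardMap_apply, picardMap_apply, Real.dist_eq, ← mul_sub, add_sub_add_left_eq_sub, abs_mul,
    abs_of_pos (exp_pos _), ← intervalIntegral.integral_sub (hI hv) (hI hw)]
  simp_rw [← mul_sub, ← radMean_sub hv hw]
  have h1 := abs_integral_mul_radMean_le n (C := K * dist v w) hL (fun x => by
    have := hg.dist_le_mul (exp (L * |x|) * v x) (exp (L * |x|) * w x)
    rw [Real.dist_eq, Real.dist_eq, ← mul_sub, abs_mul, abs_of_pos (exp_pos _)] at this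
    have h3 := BoundedContinuousFunction.dist_coe_le_dist (f := v) (g := w) x
    rw [Real.dist_eq] at h3
    calc _ ≤ _ := this
      _ ≤ K * (exp (L * |x|) * dist v w) := by gcongr
      _ = _ := by ring) (abs_nonneg s)
  have h5 : exp (-(L * |s|)) * exp (L * |s|) = 1 := by rw [← exp_add]; simp
  have h6 : (K : ℝ) / L ^ 2 ≤ 1 / 4 := by
    rw [div_le_div_iff₀ (by positivity) (by norm_num)]
    nlinarith [sq_nonneg ((K : ℝ) - 1)]
  calc _ ≤ exp (-(L * |s|)) * (K * dist v w / L ^ 2 * exp (L * |s|)) := by gcongr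
    _ = K / L ^ 2 * dist v w * (exp (-(L * |s|)) * exp (L * |s|)) := by ring
    _ ≤ 1 / 4 * dist v w * 1 := by rw [h5]; gcongr
    _ = _ := by push_cast; ring

include hg hg0 in
/-- Global solvability of `u'' + (n/s) u' = g(u)`, `u(0) = γ`, `u'(0) = 0` for Lipschitz `g`. The
derivative is written as `s * J γ s`, and `J` depends continuously on `(γ, s)`. -/
theorem exists_radial_ivp_family :
    ∃ u J : ℝ → ℝ → ℝ, (Continuous fun q : ℝ × ℝ => J q.1 q.2) ∧
      ∀ γ, u γ 0 = γ ∧ (∀ s, 0 ≤ s → HasDerivAt (u γ) (s * J γ s) s) ∧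
        (∀ s, 0 ≤ s → HasDerivAt (fun t => t * J γ t) (g (u γ s) - n * J γ s) s) ∧
        (∀ s, 0 ≤ s → J γ s = radMean n (fun x => g (u γ x)) s) := by
  set L : ℝ := K + 1
  have hL : 0 < L := by positivity
  let v : ℝ → BoundedContinuousFunction ℝ ℝ := fun γ =>
    ContractingWith.fixedPoint _ (contractingWith_picardMap (n := n) hg hg0 γ)
  have hvfix : ∀ γ, picardMap n hg hg0 hL γ (v γ) = v γ := fun γ =>
    ContractingWith.fixedPoint_isFixedPt (contractingWith_picardMap (n := n) hg hg0 γ)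
  have hvc : Continuous v := by
    have : LipschitzWith 2 v := by
      apply LipschitzWith.of_dist_le_mul
      intro γ γ'
      have := (contractingWith_picardMap (n := n) hg hg0 γ).fixedPoint_lipschitz_in_map
        (contractingWith_picardMap (n := n) hg hg0 γ')
        (fun z => dist_picardMap_initial hg hg0 hL γ γ' z)
      refine this.trans ?_
      rw [Real.dist_eq]
      push_cast
      have := abs_nonneg (γ - γ')
      rw [div_le_iff₀ (by norm_num)]
      linarith
    exact this.continuous
  let h : ℝ → ℝ → ℝ := fun γ x => g (exp (L * |x|) * v γ x)
  have hjoint : Continuous fun q : ℝ × ℝ => h q.1 q.2 := by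
    have : Continuous fun q : ℝ × ℝ => v q.1 q.2 :=
      (continuous_eval (F := BoundedContinuousFunction ℝ ℝ)).comp
        (f := fun q : ℝ × ℝ => (v q.1, q.2)) (by fun_prop)
    exact hg.continuous.comp (by fun_prop)
  have hh : ∀ γ, Continuous (h γ) := fun γ => continuous_weighted (L := L) (v γ) hg
  let u : ℝ → ℝ → ℝ := fun γ s => γ + ∫ t in (0:ℝ)..s, t * radMean n (h γ) t
  have hgu : ∀ γ s, 0 ≤ s → g (u γ s) = h γ s := by
    intro γ s hs
    have h1 := congrArg (fun f => f s) (hvfix γ)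
    simp only [picardMap_apply] at h1
    simp only [h, u]
    rw [← h1, ← mul_assoc, ← exp_add]
    simp [abs_of_nonneg hs]
  refine ⟨u, fun γ => radMean n (h γ), continuous_radMean_family n hjoint, fun γ => ⟨by simp [u],
    fun s hs => ?_, fun s hs => ?_, fun s hs => ?_⟩⟩
  · have hc : Continuous fun t => t * radMean n (h γ) t :=
      continuous_id.mul (continuous_radMean n (hh γ))
    exact (intervalIntegral.integral_hasDerivAt_right (hc.intervalIntegrable _ _)
      hc.stronglyMeasurable.stronglyMeasurableAtFilter hc.continuousAt).const_add γ
  · rw [hgu γ s hs]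
    exact hasDerivAt_mul_radMean n (hh γ) s
  · unfold radMean
    apply intervalIntegral.integral_congr
    intro σ hσ
    rw [uIcc_of_le zero_le_one] at hσ
    simp only
    rw [hgu γ _ (mul_nonneg hs hσ.1)]

end Picard

/-- The positive zero of the potential `x²/2 - x^(p+1)/(p+1)`, i.e. the height of the homoclinic
orbit of `u'' - u + u^p = 0`. -/
def homMax (p : ℝ) : ℝ := ((p + 1) / 2) ^ (1 / (p - 1))

/-- The potential `x²/2 - x^(p+1)/(p+1)`. -/
def pot (p x : ℝ) : ℝ := x ^ 2 / 2 - x ^ (p + 1) / (p + 1)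

/-- The nonlinearity `x - x^p`, frozen outside `[0, homMax p]`. -/
def truncNL (p x : ℝ) : ℝ := max 0 (min x (homMax p)) - max 0 (min x (homMax p)) ^ p

theorem pot_eq {p x : ℝ} (hx : 0 < x) : pot p x = x ^ 2 * (1 / 2 - x ^ (p - 1) / (p + 1)) := by
  have h : x ^ (p + 1) = x ^ 2 * x ^ (p - 1) := by
    rw [← rpow_natCast, ← rpow_add hx]; congr 1; push_cast; ring
  rw [pot, h]; ring

theorem truncNL_eq {p x : ℝ} (hx : 0 ≤ x) (hxM : x ≤ homMax p) : truncNL p x = x - x ^ p := by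
  rw [truncNL, min_eq_left hxM, max_eq_right hx]

section Potential

variable {p : ℝ} (hp : 1 < p)

include hp

theorem one_lt_homMax : 1 < homMax p :=
  one_lt_rpow (by linarith) (by have : 0 < p - 1 := by linarith
                                positivity)

theorem homMax_rpow : homMax p ^ (p - 1) = (p + 1) / 2 := by
  have : p - 1 ≠ 0 := by linarith
  rw [homMax, ← rpow_mul (by linarith), one_div_mul_cancel this, rpow_one]

theorem pot_pos {x : ℝ} (hx : 0 < x) (hxM : x < homMax p) : 0 < pot p x := by
  rw [pot_eq hx]
  have h1 : x ^ (p - 1) < (p + 1) / 2 := by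
    rw [← homMax_rpow hp]; exact rpow_lt_rpow hx.le hxM (by linarith)
  have h2 : x ^ (p - 1) / (p + 1) < 1 / 2 := by
    rw [div_lt_iff₀ (by linarith)]; linarith
  have : 0 < 1 / 2 - x ^ (p - 1) / (p + 1) := by linarith
  positivity

theorem pot_homMax : pot p (homMax p) = 0 := by
  rw [pot_eq (by linarith [one_lt_homMax hp]), homMax_rpow hp]
  have : p + 1 ≠ 0 := by linarith
  field_simp; simp

theorem pot_le {x : ℝ} (hx : 0 ≤ x) : pot p x ≤ x ^ 2 / 2 := by
  have := rpow_nonneg hx (p + 1)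
  have : 0 ≤ x ^ (p + 1) / (p + 1) := by have : 0 < p + 1 := by linarith
                                         positivity
  rw [pot]; linarith

theorem hasDerivAt_pot (x : ℝ) : HasDerivAt (pot p) (x - x ^ p) x := by
  have h1 := ((hasDerivAt_pow 2 x).div_const 2).sub
    ((hasDerivAt_rpow_const (x := x) (p := p + 1) (Or.inr (by linarith))).div_const (p + 1))
  refine h1.congr_deriv ?_
  have : p + 1 ≠ 0 := by linarith
  simp only [add_sub_cancel_right]
  field_simp; simp; ring

theorem continuous_pot : Continuous (pot p) :=
  continuous_iff_continuousAt.2 fun x => (hasDerivAt_pot hp x).continuousAt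

theorem exists_pot_lower_bound {a b : ℝ} (ha : 0 < a) (hb : b < homMax p) :
    ∃ c > 0, ∀ x ∈ Icc a b, c ≤ pot p x := by
  rcases (Icc a b).eq_empty_or_nonempty with h | h
  · exact ⟨1, one_pos, by simp [h]⟩
  · obtain ⟨x, hx, hmin⟩ := isCompact_Icc.exists_isMinOn h (continuous_pot hp).continuousOn
    exact ⟨pot p x, pot_pos hp (ha.trans_le hx.1) (hx.2.trans_lt hb), fun y hy => hmin hy⟩

theorem sub_rpow_pos {x : ℝ} (hx : 0 < x) (hx1 : x < 1) : 0 < x - x ^ p := by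
  have := rpow_lt_rpow_of_exponent_gt hx hx1 hp
  rw [rpow_one] at this; linarith

theorem sub_rpow_le {b x : ℝ} (hb : 1 < b) (hx : b ≤ x) : x - x ^ p ≤ b - b ^ p := by
  have e : ∀ y : ℝ, 0 < y → y ^ p = y * y ^ (p - 1) := fun y hy => by
    rw [← rpow_one_add' hy.le (by linarith)]; congr 1; ring
  have h1 : b ^ (p - 1) ≤ x ^ (p - 1) := rpow_le_rpow (by linarith) hx (by linarith)
  have h2 : 1 ≤ b ^ (p - 1) := one_le_rpow hb.le (by linarith)
  rw [e x (by linarith), e b (by linarith)]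
  nlinarith

theorem sub_rpow_neg {b : ℝ} (hb : 1 < b) : b - b ^ p < 0 := by
  have := rpow_lt_rpow_of_exponent_lt hb hp
  rw [rpow_one] at this; linarith

theorem truncNL_of_nonpos {x : ℝ} (hx : x ≤ 0) : truncNL p x = 0 := by
  rw [truncNL, max_eq_left ((min_le_left _ _).trans hx), zero_rpow (by linarith), sub_zero]

theorem truncNL_of_ge {x : ℝ} (hx : homMax p ≤ x) : truncNL p x < 0 := by
  have := one_lt_homMax hp
  rw [truncNL, min_eq_right hx, max_eq_right (by linarith)]
  exact sub_rpow_neg hp this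

theorem exists_lipschitzWith_truncNL : ∃ K, LipschitzWith K (truncNL p) := by
  have hM := one_lt_homMax hp
  have h1 : ∃ K, LipschitzOnWith K (fun x : ℝ => x - x ^ p) (Icc 0 (homMax p)) := by
    refine ⟨Real.toNNReal (1 + p * homMax p ^ (p - 1)), ?_⟩
    apply (convex_Icc 0 (homMax p)).lipschitzOnWith_of_nnnorm_hasDerivWithin_le
      (f' := fun x => 1 - p * x ^ (p - 1))
    · intro x _
      exact ((hasDerivAt_id x).sub (hasDerivAt_rpow_const (Or.inr hp.le))).hasDerivWithinAt
    · intro x hx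
      rw [← norm_toNNReal, Real.norm_eq_abs]
      apply Real.toNNReal_le_toNNReal
      have h2 := rpow_nonneg hx.1 (p - 1)
      have h3 : x ^ (p - 1) ≤ homMax p ^ (p - 1) := rpow_le_rpow hx.1 hx.2 (by linarith)
      rw [abs_le]
      constructor <;> nlinarith
  obtain ⟨K, hK⟩ := h1
  refine ⟨K, LipschitzWith.of_dist_le_mul fun x y => ?_⟩
  have hm : ∀ z : ℝ, max 0 (min z (homMax p)) ∈ Icc 0 (homMax p) := fun z =>
    ⟨le_max_left _ _, max_le (by linarith) (min_le_right _ _)⟩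
  refine (hK.dist_le_mul _ (hm x) _ (hm y)).trans ?_
  gcongr
  have : LipschitzWith 1 fun z : ℝ => max 0 (min z (homMax p)) :=
    (LipschitzWith.id.min_const _).const_max 0
  simpa using this.dist_le_mul x y

theorem integral_truncNL {x : ℝ} (hx : 0 ≤ x) (hxM : x ≤ homMax p) :
    ∫ y in (0:ℝ)..x, truncNL p y = pot p x := by
  rw [intervalIntegral.integral_eq_sub_of_hasDerivAt (f := pot p)]
  · have : p + 1 ≠ 0 := by linarith
    simp [pot, this]
  · intro y hy
    rw [uIcc_of_le hx] at hy
    rw [truncNL_eq hy.1 (hy.2.trans hxM)]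
    exact hasDerivAt_pot hp y
  · obtain ⟨K, hK⟩ := exists_lipschitzWith_truncNL hp
    exact hK.continuous.intervalIntegrable _ _

theorem mem_Ioo_of_integral_truncNL_pos {x : ℝ} (hx : 0 < ∫ y in (0:ℝ)..x, truncNL p y) :
    x ∈ Ioo 0 (homMax p) := by
  obtain ⟨K, hK⟩ := exists_lipschitzWith_truncNL hp
  have hM := one_lt_homMax hp
  by_contra hcon
  rw [mem_Ioo, not_and_or, not_lt, not_lt] at hcon
  rcases hcon with h | h
  · have : ∫ y in (0:ℝ)..x, truncNL p y = ∫ y in (0:ℝ)..x, (0:ℝ) := by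
      apply intervalIntegral.integral_congr
      intro y hy
      rw [uIcc_of_ge h] at hy
      exact truncNL_of_nonpos hp hy.2
    simp [this] at hx
  · rw [← intervalIntegral.integral_add_adjacent_intervals (b := homMax p)
      (hK.continuous.intervalIntegrable _ _) (hK.continuous.intervalIntegrable _ _),
      integral_truncNL hp (by linarith) le_rfl, pot_homMax hp, zero_add] at hx
    have : ∫ y in (homMax p)..x, truncNL p y ≤ ∫ y in (homMax p)..x, (0:ℝ) := by
      apply intervalIntegral.integral_mono_on h (hK.continuous.intervalIntegrable _ _) (by simp)
      intro y hy
      exact (truncNL_of_ge hp hy.1).le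
    simp at this
    linarith

end Potential

/-- `u` is the solution of `u'' + (n/s) u' = u - u^p`, `u(0) = γ`, `u'(0) = 0` on `[0, ∞)`, with
derivative `u' = s * J s`, staying in `(0, homMax p)`; moreover `u' > 0` until `u` reaches `1`. -/
structure RadialSol (n : ℕ) (p γ : ℝ) (u J : ℝ → ℝ) : Prop where
  init : u 0 = γ
  continuous_J : Continuous J
  hasDerivAt_u : ∀ s, 0 ≤ s → HasDerivAt u (s * J s) s
  hasDerivAt_u' : ∀ s, 0 ≤ s → HasDerivAt (fun t => t * J t) (u s - u s ^ p - n * J s) s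
  pos : ∀ s, 0 ≤ s → 0 < u s
  lt_homMax : ∀ s, 0 ≤ s → u s < homMax p
  J_pos : ∀ s, 0 ≤ s → (∀ t ∈ Icc 0 s, u t < 1) → 0 < J s

theorem exists_radialSol_family (n : ℕ) {p : ℝ} (hp : 1 < p) :
    ∃ u J : ℝ → ℝ → ℝ, (Continuous fun q : ℝ × ℝ => J q.1 q.2) ∧
      ∀ γ ∈ Ioo (0:ℝ) 1, RadialSol n p γ (u γ) (J γ) := by
  obtain ⟨K, hK⟩ := exists_lipschitzWith_truncNL hp
  obtain ⟨u, J, hJ, H⟩ := exists_radial_ivp_family (n := n) hK (truncNL_of_nonpos hp le_rfl)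
  have hM := one_lt_homMax hp
  refine ⟨u, J, hJ, fun γ hγ => ?_⟩
  obtain ⟨h0, h1, h2, h3⟩ := H γ
  have hmem : ∀ s, 0 ≤ s → u γ s ∈ Ioo 0 (homMax p) := by
    intro s hs
    apply mem_Ioo_of_integral_truncNL_pos hp
    set Q : ℝ → ℝ := fun x => ∫ y in (0:ℝ)..x, truncNL p y with hQ
    have hQd : ∀ x, HasDerivAt Q (truncNL p x) x := fun x =>
      intervalIntegral.integral_hasDerivAt_right (hK.continuous.intervalIntegrable _ _)
        hK.continuous.stronglyMeasurable.stronglyMeasurableAtFilter hK.continuous.continuousAt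
    have hE : ∀ t, 0 ≤ t → HasDerivAt (fun t => (t * J γ t) ^ 2 / 2 - Q (u γ t))
        (- (n * t * J γ t ^ 2)) t := by
      intro t ht
      have := (((h2 t ht).pow 2).div_const 2).sub ((hQd (u γ t)).comp t (h1 t ht))
      refine this.congr_deriv ?_
      push_cast; ring
    have hanti : AntitoneOn (fun t => (t * J γ t) ^ 2 / 2 - Q (u γ t)) (Ici 0) := by
      apply antitoneOn_of_deriv_nonpos (convex_Ici 0)
      · exact fun t ht => (hE t ht).continuousAt.continuousWithinAt
      · intro t ht
        rw [interior_Ici] at ht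
        exact (hE t (le_of_lt ht)).differentiableAt.differentiableWithinAt
      · intro t ht
        rw [interior_Ici] at ht
        have ht : 0 < t := ht
        rw [(hE t ht.le).deriv]
        have : 0 ≤ n * t * J γ t ^ 2 := by positivity
        linarith
    have h4 := hanti (mem_Ici.2 le_rfl) hs hs
    have h5 : 0 < Q γ := by
      rw [hQ]; simp only
      rw [integral_truncNL hp hγ.1.le (by linarith [hγ.2])]
      exact pot_pos hp hγ.1 (by linarith [hγ.2])
    simp only [zero_mul, h0] at h4
    have := sq_nonneg (s * J γ s)
    change 0 < Q (u γ s)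
    linarith
  refine ⟨h0, hJ.comp (f := fun s => (γ, s)) (by fun_prop), h1, fun s hs => ?_,
    fun s hs => (hmem s hs).1, fun s hs => (hmem s hs).2, fun s hs hlt => ?_⟩
  · rw [← truncNL_eq (hmem s hs).1.le (hmem s hs).2.le]; exact h2 s hs
  · rw [h3 s hs, radMean]
    have hm : ∀ σ ∈ Icc (0:ℝ) 1, s * σ ∈ Icc 0 s := fun σ hσ =>
      ⟨mul_nonneg hs hσ.1, mul_le_of_le_one_right hs hσ.2⟩
    apply intervalIntegral.intervalIntegral_pos_of_pos_on _ _ zero_lt_one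
    · apply ContinuousOn.intervalIntegrable
      rw [uIcc_of_le zero_le_one]
      refine (by fun_prop : Continuous fun σ : ℝ => σ ^ n).continuousOn.mul
        (hK.continuous.comp_continuousOn ?_)
      have : ContinuousOn (u γ) (Icc 0 s) := fun t ht =>
        (h1 t ht.1).continuousAt.continuousWithinAt
      exact this.comp (by fun_prop) hm
    · intro σ hσ
      have hσ' := hm σ (Ioo_subset_Icc_self hσ)
      have h6 := hmem _ hσ'.1
      rw [truncNL_eq h6.1.le h6.2.le]
      exact mul_pos (pow_pos hσ.1 n) (sub_rpow_pos hp h6.1 (hlt _ hσ'))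

namespace RadialSol

variable {n : ℕ} {p γ : ℝ} {u J : ℝ → ℝ}

theorem init_pos (h : RadialSol n p γ u J) : 0 < γ := h.init ▸ h.pos 0 le_rfl

theorem monotoneOn (h : RadialSol n p γ u J) {R : ℝ} (hJ : ∀ s ∈ Icc 0 R, 0 ≤ J s) :
    MonotoneOn u (Icc 0 R) := by
  apply monotoneOn_of_deriv_nonneg (convex_Icc 0 R)
  · exact fun t ht => (h.hasDerivAt_u t ht.1).continuousAt.continuousWithinAt
  · intro t ht
    rw [interior_Icc] at ht
    exact (h.hasDerivAt_u t ht.1.le).differentiableAt.differentiableWithinAt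
  · intro t ht
    rw [interior_Icc] at ht
    rw [(h.hasDerivAt_u t ht.1.le).deriv]
    exact mul_nonneg ht.1.le (hJ t ⟨ht.1.le, ht.2.le⟩)

theorem hasDerivAt_energy (h : RadialSol n p γ u J) (hp : 1 < p) {t : ℝ} (ht : 0 ≤ t) :
    HasDerivAt (fun t => (t * J t) ^ 2 / 2 - pot p (u t)) (-(n * t * J t ^ 2)) t := by
  have := (((h.hasDerivAt_u' t ht).pow 2).div_const 2).sub
    ((hasDerivAt_pot hp (u t)).comp t (h.hasDerivAt_u t ht))
  refine this.congr_deriv ?_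
  push_cast; ring

theorem mul_J_le (h : RadialSol n p γ u J) (hp : 1 < p) {s : ℝ} (hs : 0 ≤ s) :
    s * J s ≤ u s := by
  have hanti : AntitoneOn (fun t => (t * J t) ^ 2 / 2 - pot p (u t)) (Ici 0) := by
    apply antitoneOn_of_deriv_nonpos (convex_Ici 0)
    · exact fun t ht => (h.hasDerivAt_energy hp ht).continuousAt.continuousWithinAt
    · intro t ht
      rw [interior_Ici] at ht
      exact (h.hasDerivAt_energy hp (le_of_lt ht)).differentiableAt.differentiableWithinAt
    · intro t ht
      rw [interior_Ici] at ht
      have ht : 0 < t := ht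
      rw [(h.hasDerivAt_energy hp ht.le).deriv]
      have : 0 ≤ n * t * J t ^ 2 := by positivity
      linarith
  have h4 := hanti (mem_Ici.2 le_rfl) hs hs
  have h5 := pot_pos hp (h.pos 0 le_rfl) (h.lt_homMax 0 le_rfl)
  have h6 := pot_le hp (h.pos s hs).le
  simp only [zero_mul] at h4
  apply le_of_sq_le_sq _ (h.pos s hs).le
  linarith

theorem le_mul_exp (h : RadialSol n p γ u J) (hp : 1 < p) {s : ℝ} (hs : 0 ≤ s) :
    u s ≤ γ * exp s := by
  have hd : ∀ t, 0 ≤ t →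
      HasDerivAt (fun t => u t * exp (-t)) ((t * J t - u t) * exp (-t)) t := by
    intro t ht
    have := (h.hasDerivAt_u t ht).mul ((hasDerivAt_id t).neg.exp)
    refine this.congr_deriv ?_
    simp; ring
  have hanti : AntitoneOn (fun t => u t * exp (-t)) (Ici 0) := by
    apply antitoneOn_of_deriv_nonpos (convex_Ici 0)
    · exact fun t ht => (hd t ht).continuousAt.continuousWithinAt
    · intro t ht
      rw [interior_Ici] at ht
      exact (hd t (le_of_lt ht)).differentiableAt.differentiableWithinAt
    · intro t ht
      rw [interior_Ici] at ht
      have ht : 0 < t := ht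
      rw [(hd t ht.le).deriv]
      exact mul_nonpos_of_nonpos_of_nonneg (by linarith [h.mul_J_le hp ht.le]) (exp_pos _).le
  have h1 := hanti (mem_Ici.2 le_rfl) hs hs
  simp only [neg_zero, exp_zero, mul_one, h.init] at h1
  calc u s = u s * exp (-s) * exp s := by rw [mul_assoc, ← exp_add]; simp
    _ ≤ γ * exp s := by gcongr

end RadialSol

section SmallInitialValue

variable (n : ℕ) {p : ℝ} (hp : 1 < p)

include hp

/-- For small initial values the energy loss along the increasing part of `u` is small. -/
theorem exists_energy_lower_bound {ε : ℝ} (hε : 0 < ε) :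
    ∃ γ₀ > 0, ∀ γ < γ₀, ∀ u J, RadialSol n p γ u J → ∀ R, (∀ s ∈ Icc 0 R, 0 ≤ J s) →
      ∀ s ∈ Icc 0 R, pot p (u s) - ε ≤ (s * J s) ^ 2 / 2 := by
  set M := homMax p
  have hM : 1 < M := one_lt_homMax hp
  set S : ℝ := 2 * n * M ^ 2 / ε + 1 with hS
  have hS0 : 0 < S := by positivity
  have hSε : n * M ^ 2 / S ≤ ε / 2 := by
    rw [div_le_iff₀ hS0, hS]
    have : ε / 2 * (2 * n * M ^ 2 / ε + 1) = n * M ^ 2 + ε / 2 := by field_simp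
    linarith
  refine ⟨sqrt ε * exp (-S), by positivity, fun γ hγ u J h R hJ => ?_⟩
  have hγ0 := h.init_pos
  have early : ∀ s ∈ Icc 0 S, pot p (u s) ≤ ε / 2 := by
    intro s hs
    have h1 := h.le_mul_exp hp hs.1
    have h2 : γ * exp s ≤ sqrt ε := by
      calc γ * exp s ≤ sqrt ε * exp (-S) * exp S := by gcongr; exact hs.2
        _ = sqrt ε := by rw [mul_assoc, ← exp_add]; simp
    have h3 := h.pos s hs.1
    have h4 : u s ^ 2 ≤ ε := by
      rw [← sq_sqrt hε.le]; exact pow_le_pow_left₀ h3.le (h1.trans h2) 2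
    linarith [pot_le hp h3.le]
  intro s hs
  rcases le_total s S with hsS | hsS
  · have := sq_nonneg (s * J s)
    linarith [early s ⟨hs.1, hsS⟩]
  · have hd : ∀ t, 0 ≤ t → HasDerivAt
        (fun t => ((t * J t) ^ 2 / 2 - pot p (u t)) + n * M / S * u t)
        (-(n * t * J t ^ 2) + n * M / S * (t * J t)) t := fun t ht =>
      (h.hasDerivAt_energy hp ht).add ((h.hasDerivAt_u t ht).const_mul _)
    have hmono : MonotoneOn
        (fun t => ((t * J t) ^ 2 / 2 - pot p (u t)) + n * M / S * u t) (Icc S R) := by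
      apply monotoneOn_of_deriv_nonneg (convex_Icc S R)
      · exact fun t ht => (hd t (hS0.le.trans ht.1)).continuousAt.continuousWithinAt
      · intro t ht
        rw [interior_Icc] at ht
        exact (hd t (hS0.le.trans ht.1.le)).differentiableAt.differentiableWithinAt
      · intro t ht
        rw [interior_Icc] at ht
        have ht0 : 0 < t := hS0.trans ht.1
        rw [(hd t ht0.le).deriv]
        have hJt := hJ t ⟨ht0.le, ht.2.le⟩
        have h1 : J t ≤ M / S := by
          rw [le_div_iff₀ hS0]
          have := (h.mul_J_le hp ht0.le).trans (h.lt_homMax t ht0.le).le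
          nlinarith [ht.1]
        have h2 : -(n * t * J t ^ 2) + n * M / S * (t * J t) = n * t * J t * (M / S - J t) := by
          ring
        rw [h2]
        have : 0 ≤ M / S - J t := by linarith
        positivity
    have h1 := hmono ⟨le_rfl, hsS.trans hs.2⟩ ⟨hsS, hs.2⟩ hsS
    simp only at h1
    have h2 := early S ⟨hS0.le, le_rfl⟩
    have h3 := sq_nonneg (S * J S)
    have h4 : n * M / S * u s ≤ n * M / S * M := by
      have := (h.lt_homMax s hs.1).le
      gcongr
    have h5 : n * M / S * M = n * M ^ 2 / S := by ring
    have h6 : 0 ≤ n * M / S * u S := by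
      have := h.pos S hS0.le
      positivity
    linarith

/-- For small initial values, the increasing part of `u` above a level `ε` has bounded length. -/
theorem exists_transit_time_bound {ε : ℝ} (hε : 0 < ε) :
    ∃ γ₀ > 0, ∃ T : ℝ, ∀ γ < γ₀, ∀ u J, RadialSol n p γ u J → ∀ R, (∀ s ∈ Icc 0 R, 0 ≤ J s) →
      ∀ a ∈ Icc 0 R, ε ≤ u a → R - a ≤ T := by
  set M := homMax p
  have hM : 1 < M := one_lt_homMax hp
  obtain ⟨b, hb1, hbM⟩ := exists_between hM
  obtain ⟨c, hc, hcpot⟩ := exists_pot_lower_bound hp hε hbM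
  obtain ⟨γ₀, hγ₀, H⟩ := exists_energy_lower_bound n hp (half_pos hc)
  set k := sqrt c with hk
  have hk0 : 0 < k := sqrt_pos.2 hc
  set d := b ^ p - b with hd
  have hd0 : 0 < d := by linarith [sub_rpow_neg hp hb1]
  refine ⟨γ₀, hγ₀, M / k + M / d, fun γ hγ u J h R hJ a ha hεa => ?_⟩
  have hmono := h.monotoneOn hJ
  set a' := a + M / k with ha'
  have haa' : a < a' := by have : 0 < M / k := by positivity
                           linarith
  rcases le_or_gt R a' with hR | hR
  · have : 0 < M / d := by positivity
    linarith
  have ha'0 : 0 ≤ a' := ha.1.trans haa'.le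
  have hba' : b ≤ u a' := by
    by_contra! hlt
    have hder : ∀ t ∈ interior (Icc a a'), k ≤ deriv u t := by
      intro t ht
      rw [interior_Icc] at ht
      have ht0 : 0 ≤ t := ha.1.trans ht.1.le
      rw [(h.hasDerivAt_u t ht0).deriv]
      have htR : t ∈ Icc 0 R := ⟨ht0, ht.2.le.trans hR.le⟩
      have h1 := H γ hγ u J h R hJ t htR
      have h2 := hcpot (u t) ⟨hεa.trans (hmono ha htR ht.1.le),
        (hmono htR ⟨ha'0, hR.le⟩ ht.2.le).trans hlt.le⟩
      have h3 := mul_nonneg ht0 (hJ t htR)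
      rw [hk]
      apply sqrt_le_left h3 |>.2
      linarith
    have := (convex_Icc a a').mul_sub_le_image_sub_of_le_deriv
      (fun t ht => (h.hasDerivAt_u t (ha.1.trans ht.1)).continuousAt.continuousWithinAt)
      (fun t ht => (h.hasDerivAt_u t
        (ha.1.trans (interior_subset ht).1)).differentiableAt.differentiableWithinAt)
      hder a ⟨le_rfl, haa'.le⟩ a' ⟨haa'.le, le_rfl⟩ haa'.le
    have h4 : k * (a' - a) = M := by rw [ha']; field_simp; ring
    linarith [h.pos a ha.1]
  have hder : ∀ t ∈ interior (Icc a' R), deriv (fun t => t * J t) t ≤ -d := by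
    intro t ht
    rw [interior_Icc] at ht
    have ht0 : 0 ≤ t := ha'0.trans ht.1.le
    have htR : t ∈ Icc 0 R := ⟨ht0, ht.2.le⟩
    rw [(h.hasDerivAt_u' t ht0).deriv]
    have h1 := sub_rpow_le hp hb1 (hba'.trans (hmono ⟨ha'0, hR.le⟩ htR ht.1.le))
    have h2 : 0 ≤ n * J t := mul_nonneg (Nat.cast_nonneg _) (hJ t htR)
    linarith
  have h1 := (convex_Icc a' R).image_sub_le_mul_sub_of_deriv_le
    (fun t ht => (h.hasDerivAt_u' t (ha'0.trans ht.1)).continuousAt.continuousWithinAt)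
    (fun t ht => (h.hasDerivAt_u' t
      (ha'0.trans (interior_subset ht).1)).differentiableAt.differentiableWithinAt)
    hder a' ⟨le_rfl, hR.le⟩ R ⟨hR.le, le_rfl⟩ hR.le
  have h2 : 0 ≤ R * J R := mul_nonneg (ha'0.trans hR.le) (hJ R ⟨ha'0.trans hR.le, le_rfl⟩)
  have h3 := (h.mul_J_le hp ha'0).trans (h.lt_homMax a' ha'0).le
  have h4 : R - a' ≤ M / d := by
    rw [le_div_iff₀ hd0]; linarith
  linarith

/-- The level `1/2` is reached in a time bounded in terms of a lower bound of the initial value. -/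
theorem exists_start_time_bound {γ₁ : ℝ} (hγ₁ : 0 < γ₁) :
    ∃ T > 0, ∀ γ ≥ γ₁, ∀ u J, RadialSol n p γ u J → ∀ R > T, (∀ s ∈ Icc 0 R, 0 ≤ J s) →
      1 / 2 ≤ u T := by
  set M := homMax p
  have hM : 1 < M := one_lt_homMax hp
  have hcont : Continuous fun x : ℝ => x - x ^ p :=
    continuous_id.sub (continuous_rpow_const (by linarith))
  obtain ⟨c, hc, hcq⟩ : ∃ c > 0, ∀ x ∈ Icc γ₁ (1 / 2), c ≤ x - x ^ p := by
    rcases (Icc γ₁ (1 / 2)).eq_empty_or_nonempty with he | he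
    · exact ⟨1, one_pos, fun x hx => (he ▸ hx : x ∈ (∅ : Set ℝ)).elim⟩
    · obtain ⟨x, hx, hmin⟩ := isCompact_Icc.exists_isMinOn he hcont.continuousOn
      exact ⟨_, sub_rpow_pos hp (hγ₁.trans_le hx.1) (by linarith [hx.2]), fun y hy => hmin hy⟩
  set T := 1 + (n + 1) * M / c with hT
  have hT1 : 1 < T := by have : 0 < (n + 1) * M / c := by positivity
                         linarith
  refine ⟨T, by linarith, fun γ hγ u J h R hR hJ => ?_⟩
  by_contra! hlt
  have hmono := h.monotoneOn hJ
  have hd : ∀ t, 0 ≤ t → HasDerivAt (fun t => t * J t + n * u t)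
      (u t - u t ^ p - n * J t + n * (t * J t)) t := fun t ht =>
    (h.hasDerivAt_u' t ht).add ((h.hasDerivAt_u t ht).const_mul _)
  have h1 := (convex_Icc 1 T).mul_sub_le_image_sub_of_le_deriv (C := c)
    (fun t ht => (hd t (zero_le_one.trans ht.1)).continuousAt.continuousWithinAt)
    (fun t ht => (hd t
      (zero_le_one.trans (interior_subset ht).1)).differentiableAt.differentiableWithinAt)
    (by
      intro t ht
      rw [interior_Icc] at ht
      have ht0 : 0 ≤ t := zero_le_one.trans ht.1.le
      have htR : t ∈ Icc 0 R := ⟨ht0, ht.2.le.trans hR.le⟩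
      rw [(hd t ht0).deriv]
      have h2 := hcq (u t) ⟨hγ.trans (h.init ▸ hmono ⟨le_rfl, ht0.trans htR.2⟩ htR ht0),
        (hmono htR ⟨by linarith, hR.le⟩ ht.2.le).trans hlt.le⟩
      have h3 : 0 ≤ n * ((t - 1) * J t) := mul_nonneg (Nat.cast_nonneg _)
        (mul_nonneg (by linarith [ht.1]) (hJ t htR))
      linarith)
    1 ⟨le_rfl, hT1.le⟩ T ⟨hT1.le, le_rfl⟩ hT1.le
  simp only [one_mul] at h1
  have h2 : c * (T - 1) = (n + 1) * M := by rw [hT]; field_simp; ring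
  have h3 := (h.mul_J_le hp (by linarith : 0 ≤ T))
  have h4 := h.lt_homMax T (by linarith)
  have h5 := hJ 1 ⟨zero_le_one, by linarith⟩
  have h6 := h.pos 1 zero_le_one
  have h7 : (n:ℝ) * u T ≤ n * M := by gcongr
  have h8 : 0 ≤ n * u 1 := by positivity
  linarith

/-- Solutions with initial value in `[γ₁, γ₀)` stop increasing before a uniform time. -/
theorem exists_increasing_time_bound :
    ∃ γ₀ > 0, ∀ γ₁ > 0, ∃ T : ℝ, ∀ γ < γ₀, γ₁ ≤ γ → ∀ u J, RadialSol n p γ u J →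
      ∀ R, (∀ s ∈ Icc 0 R, 0 ≤ J s) → R ≤ T := by
  obtain ⟨γ₀, hγ₀, T, H⟩ := exists_transit_time_bound n hp (ε := 1 / 2) (by norm_num)
  refine ⟨γ₀, hγ₀, fun γ₁ hγ₁ => ?_⟩
  obtain ⟨T', hT', H'⟩ := exists_start_time_bound n hp hγ₁
  refine ⟨T' + max T 0, fun γ hγ hγ' u J h R hJ => ?_⟩
  by_contra! hR
  have hRT : T' < R := lt_of_le_of_lt (by linarith [le_max_right T 0]) hR
  have := H γ hγ u J h R hJ T' ⟨hT'.le, hRT.le⟩ (H' γ hγ' u J h R hRT hJ)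
  linarith [le_max_left T 0]

end SmallInitialValue

/-- Shooting: for every large `R` some small initial value makes `R` the first
positive critical point. -/
theorem exists_shooting_value (n : ℕ) {p : ℝ} (hp : 1 < p) {u J : ℝ → ℝ → ℝ}
    (hJc : Continuous fun q : ℝ × ℝ => J q.1 q.2)
    (H : ∀ γ ∈ Ioo (0:ℝ) 1, RadialSol n p γ (u γ) (J γ)) {γc : ℝ} (hγc : 0 < γc) :
    ∃ R₀ > 0, ∀ R > R₀, ∃ γ ∈ Ioo (0:ℝ) 1, γ < γc ∧
      (∀ s ∈ Ico 0 R, 0 < J γ s) ∧ J γ R = 0 := by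
  have hpot1 : 0 < pot p 1 := pot_pos hp one_pos (one_lt_homMax hp)
  obtain ⟨γa, hγa, Ha⟩ := exists_increasing_time_bound n hp
  obtain ⟨γb, hγb, Hb⟩ := exists_energy_lower_bound n hp (half_pos hpot1)
  obtain ⟨γ₀, hγ₀, hγ₀'⟩ := exists_between (lt_min hγc (lt_min hγa (lt_min hγb one_pos)))
  obtain ⟨hγ₀c, hγ₀a, hγ₀b, hγ₀1⟩ : γ₀ < γc ∧ γ₀ < γa ∧ γ₀ < γb ∧ γ₀ < 1 := by simpa using hγ₀'
  obtain ⟨T, hT⟩ := Ha γ₀ hγ₀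
  refine ⟨max T 1, by positivity, fun R hR => ?_⟩
  have hR1 : 1 < R := (le_max_right _ _).trans_lt hR
  have hRT : T < R := (le_max_left _ _).trans_lt hR
  have hne : (Icc 0 R).Nonempty := ⟨0, le_rfl, by linarith⟩
  set m : ℝ → ℝ := fun γ => sInf (J γ '' Icc 0 R) with hm
  have hmc : Continuous m := isCompact_Icc.continuous_sInf hJc
  have hJγ : ∀ γ, Continuous (J γ) := fun γ =>
    hJc.comp (f := fun s : ℝ => (γ, s)) (by fun_prop)
  have hmin : ∀ γ, ∃ s ∈ Icc 0 R, J γ s = m γ ∧ ∀ t ∈ Icc 0 R, m γ ≤ J γ t := by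
    intro γ
    obtain ⟨s, hs, h1, h2⟩ := isCompact_Icc.exists_sInf_image_eq_and_le hne (hJγ γ).continuousOn
    exact ⟨s, hs, h1.symm, fun t ht => h1.trans_le (h2 t ht)⟩
  have hm0 : m γ₀ < 0 := by
    by_contra! hcon
    obtain ⟨s, hs, h1, h2⟩ := hmin γ₀
    have := hT γ₀ hγ₀a le_rfl _ _ (H γ₀ ⟨hγ₀, hγ₀1⟩) R fun t ht => hcon.trans (h2 t ht)
    linarith
  obtain ⟨γs, hγs, hγs'⟩ := exists_between (lt_min hγ₀ (exp_pos (-R)))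
  obtain ⟨hγs0, hγsR⟩ : γs < γ₀ ∧ γs < exp (-R) := by simpa using hγs'
  have hms : 0 < m γs := by
    obtain ⟨s, hs, h1, h2⟩ := hmin γs
    have h := H γs ⟨hγs, hγs0.trans hγ₀1⟩
    rw [← h1]
    refine h.J_pos s hs.1 fun t ht => (h.le_mul_exp hp ht.1).trans_lt ?_
    calc γs * exp t ≤ γs * exp R := by gcongr; exact ht.2.trans hs.2
      _ < exp (-R) * exp R := by gcongr
      _ = 1 := by rw [← exp_add]; simp
  obtain ⟨γ, hγ, hmγ⟩ := intermediate_value_Icc' hγs0.le hmc.continuousOn ⟨hm0.le, hms.le⟩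
  have hγ1 : γ ∈ Ioo (0:ℝ) 1 := ⟨hγs.trans_le hγ.1, hγ.2.trans_lt hγ₀1⟩
  have h := H γ hγ1
  obtain ⟨s₀, hs₀, h1, h2⟩ := hmin γ
  rw [hmγ] at h1 h2
  have key : ∀ s ∈ Ico 0 R, J γ s ≠ 0 := by
    intro s hs hs0
    have hspos : 0 < s := by
      rcases hs.1.eq_or_lt with rfl | hlt
      · have := h.J_pos 0 le_rfl fun t ht => by
          rw [Icc_self, mem_singleton_iff] at ht
          rw [ht, h.init]; exact hγ1.2
        linarith
      · exact hlt
    have hloc : IsLocalMin (fun t => t * J γ t) s := by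
      filter_upwards [Ioo_mem_nhds hspos hs.2] with t ht
      rw [hs0, mul_zero]
      exact mul_nonneg ht.1.le (h2 t ⟨ht.1.le, ht.2.le⟩)
    have h3 := hloc.hasDerivAt_eq_zero (h.hasDerivAt_u' s hs.1)
    rw [hs0, mul_zero, sub_zero] at h3
    have h4 : u γ s = 1 := by
      rcases lt_trichotomy (u γ s) 1 with hlt | heq | hgt
      · linarith [sub_rpow_pos hp (h.pos s hs.1) hlt]
      · exact heq
      · linarith [sub_rpow_neg hp hgt]
    have h5 := Hb γ (hγ.2.trans_lt hγ₀b) _ _ h R h2 s ⟨hs.1, hs.2.le⟩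
    rw [h4, hs0] at h5
    simp only [mul_zero] at h5
    linarith
  refine ⟨γ, hγ1, hγ.2.trans_lt hγ₀c,
    fun s hs => lt_of_le_of_ne (h2 s ⟨hs.1, hs.2.le⟩) (key s hs).symm, ?_⟩
  rcases hs₀.2.eq_or_lt with rfl | hlt
  · exact h1
  · exact absurd h1 (key s₀ ⟨hs₀.1, hlt⟩)

namespace RadialSol

variable {n : ℕ} {p γ : ℝ} {u J : ℝ → ℝ}

theorem strictMonoOn (h : RadialSol n p γ u J) {R : ℝ} (hJ : ∀ s ∈ Ico 0 R, 0 < J s) :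
    StrictMonoOn u (Icc 0 R) := by
  apply strictMonoOn_of_deriv_pos (convex_Icc 0 R)
  · exact fun t ht => (h.hasDerivAt_u t ht.1).continuousAt.continuousWithinAt
  · intro t ht
    rw [interior_Icc] at ht
    rw [(h.hasDerivAt_u t ht.1.le).deriv]
    exact mul_pos ht.1 (hJ t ⟨ht.1.le, ht.2⟩)

theorem one_le_of_critical (h : RadialSol n p γ u J) {R : ℝ} (hR : 0 ≤ R)
    (hJ : ∀ s ∈ Ico 0 R, 0 < J s) (hJR : J R = 0) : 1 ≤ u R := by
  by_contra! hlt
  have := h.J_pos R hR fun t ht =>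
    ((h.strictMonoOn hJ).monotoneOn ht ⟨hR, le_rfl⟩ ht.2).trans_lt hlt
  linarith

theorem neumannSol (h : RadialSol n p γ u J) {lam : ℝ} (hlam : 0 < lam) (hJ : J (sqrt lam) = 0) :
    NeumannSol (n + 1) p lam (fun r => u (sqrt lam * r))
      (fun r => sqrt lam * (sqrt lam * r * J (sqrt lam * r)))
      (fun r => lam * (u (sqrt lam * r) - u (sqrt lam * r) ^ p - n * J (sqrt lam * r))) := by
  have hnn : ∀ {r : ℝ}, r ∈ Icc (0:ℝ) 1 → 0 ≤ sqrt lam * r := fun hr =>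
    mul_nonneg (sqrt_nonneg _) hr.1
  have hsq : sqrt lam * sqrt lam = lam := mul_self_sqrt hlam.le
  have hlin : ∀ r : ℝ, HasDerivAt (fun r => sqrt lam * r) (sqrt lam) r := fun r => by
    simpa using (hasDerivAt_id r).const_mul (sqrt lam)
  refine ⟨fun r hr => ?_, fun r hr => ?_, fun r hr => ?_, fun r hr => ?_, by simp, by simp [hJ],
    fun r hr => h.pos _ (hnn hr)⟩
  · have := (h.hasDerivAt_u _ (hnn hr)).comp r (hlin r)
    exact (this.congr_deriv (mul_comm _ _)).hasDerivWithinAt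
  · have := ((h.hasDerivAt_u' _ (hnn hr)).comp r (hlin r)).const_mul (sqrt lam)
    refine (this.congr_deriv ?_).hasDerivWithinAt
    rw [mul_comm _ (sqrt lam), ← mul_assoc, hsq]
  · have hu : ContinuousAt (fun r => u (sqrt lam * r)) r :=
      ((h.hasDerivAt_u _ (hnn hr)).comp r (hlin r)).continuousAt
    have hJc : Continuous fun r => J (sqrt lam * r) := h.continuous_J.comp (by fun_prop)
    have hup := hu.rpow_const (p := p) (Or.inl (h.pos _ (hnn hr)).ne')
    exact (((hu.sub hup).sub (hJc.continuousAt.const_mul (n : ℝ))).const_mul lam).continuousWithinAt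
  · have hr0 : r ≠ 0 := hr.1.ne'
    simp only [fNL]
    push_cast
    field_simp
    rw [show sqrt lam ^ 2 = lam by rw [sq, hsq]]
    ring

theorem encard_eq_one (h : RadialSol n p γ u J) (hγ : γ < 1) {R : ℝ} (hR : 0 < R)
    (hJ : ∀ s ∈ Ico 0 R, 0 < J s) (hJR : J R = 0) :
    {r ∈ Icc (0:ℝ) 1 | u (R * r) = 1}.encard = 1 := by
  have hcont : ContinuousOn u (Icc 0 R) := fun t ht =>
    (h.hasDerivAt_u t ht.1).continuousAt.continuousWithinAt
  obtain ⟨s, hs, hs1⟩ := intermediate_value_Icc hR.le hcont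
    ⟨h.init.trans_le hγ.le, h.one_le_of_critical hR.le hJ hJR⟩
  rw [Set.encard_eq_one]
  refine ⟨s / R, Set.ext fun r => ⟨fun ⟨hr, hr1⟩ => ?_, fun hr => ?_⟩⟩
  · have := (h.strictMonoOn hJ).injOn
      ⟨mul_nonneg hR.le hr.1, mul_le_of_le_one_right hR.le hr.2⟩ hs (hr1.trans hs1.symm)
    rw [mem_singleton_iff, ← this]; field_simp
  · rw [mem_singleton_iff] at hr
    subst hr
    refine ⟨⟨div_nonneg hs.1 hR.le, (div_le_one hR).2 hs.2⟩, ?_⟩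
    rw [mul_div_cancel₀ _ hR.ne', hs1]

end RadialSol

/-- Section 7: for large `λ` the Neumann problem has a solution `U_λ`
meeting `1` exactly once, which concentrates on the boundary as `λ → ∞`:
`U_λ(0) → 0`, `U_λ(1) → ((p+1)/2)^{1/(p-1)}`, and `U_λ → 0` uniformly on `[0,1-δ]`. -/
theorem boundary_concentrating_solutions (N : ℕ) (hN : 3 ≤ N) (p : ℝ) (hp : 1 < p) :
    ∃ lam₀ > (0:ℝ), ∃ U U' U'' : ℝ → ℝ → ℝ,
      (∀ lam > lam₀, NeumannSol N p lam (U lam) (U' lam) (U'' lam) ∧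
        {r ∈ Icc (0:ℝ) 1 | U lam r = 1}.encard = (1 : ℕ∞)) ∧
      Tendsto (fun lam => U lam 0) atTop (𝓝 0) ∧
      Tendsto (fun lam => U lam 1) atTop (𝓝 (((p + 1) / 2) ^ (1 / (p - 1)))) ∧
      (∀ δ ∈ Ioo (0:ℝ) 1, ∀ ε > (0:ℝ), ∃ Λ : ℝ, ∀ lam ≥ Λ,
        ∀ r ∈ Icc (0:ℝ) (1 - δ), U lam r < ε) := by

  obtain ⟨n, rfl⟩ : ∃ n, N = n + 1 := ⟨N - 1, by omega⟩
  obtain ⟨u, J, hJc, H⟩ := exists_radialSol_family n hp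
  obtain ⟨γc, hγc, HT⟩ := exists_increasing_time_bound n hp
  obtain ⟨R₀, hR₀, hshoot⟩ := exists_shooting_value n hp hJc H hγc
  choose! γ hγ hγlt hpos hzero using hshoot
  have hsol : ∀ R > R₀, RadialSol n p (γ R) (u (γ R)) (J (γ R)) := fun R hR => H _ (hγ R hR)
  have hnonneg : ∀ R > R₀, ∀ s ∈ Icc 0 R, 0 ≤ J (γ R) s := fun R hR s hs => by
    rcases hs.2.eq_or_lt with rfl | hlt
    · exact (hzero s hR).ge
    · exact (hpos R hR s ⟨hs.1, hlt⟩).le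
  have hγlim : Tendsto γ atTop (𝓝 0) := by
    rw [tendsto_order]
    refine ⟨fun b hb => ?_, fun b hb => ?_⟩
    · filter_upwards [eventually_gt_atTop R₀] with R hRR using hb.trans (hγ R hRR).1
    · obtain ⟨T, hT⟩ := HT b hb
      filter_upwards [eventually_gt_atTop R₀, eventually_gt_atTop T] with R hRR hRT
      by_contra! hle
      linarith [hT _ (hγlt R hRR) hle _ _ (hsol R hRR) R (hnonneg R hRR)]
  have hR : ∀ {lam}, lam > R₀ ^ 2 → sqrt lam > R₀ := fun h => lt_sqrt_of_sq_lt h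
  have hsqrt := tendsto_sqrt_atTop
  refine ⟨R₀ ^ 2, by positivity, fun lam r => u (γ (sqrt lam)) (sqrt lam * r),
    fun lam r => sqrt lam * (sqrt lam * r * J (γ (sqrt lam)) (sqrt lam * r)),
    fun lam r => lam * (u (γ (sqrt lam)) (sqrt lam * r) - u (γ (sqrt lam)) (sqrt lam * r) ^ p
      - n * J (γ (sqrt lam)) (sqrt lam * r)), fun lam hlam => ⟨?_, ?_⟩, ?_, ?_, ?_⟩
  · exact (hsol _ (hR hlam)).neumannSol ((pow_pos hR₀ 2).trans hlam) (hzero _ (hR hlam))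
  · exact (hsol _ (hR hlam)).encard_eq_one (hγ _ (hR hlam)).2 (hR₀.trans (hR hlam))
      (hpos _ (hR hlam)) (hzero _ (hR hlam))
  · refine (hγlim.comp hsqrt).congr' ?_
    filter_upwards [eventually_gt_atTop (R₀ ^ 2)] with lam hlam
    simp [(hsol _ (hR hlam)).init]
  · have hlim : Tendsto (fun R => u (γ R) R) atTop (𝓝 (homMax p)) := by
      rw [tendsto_order]
      refine ⟨fun b hb => ?_, fun b hb => ?_⟩
      · obtain ⟨c, hc, hcpot⟩ := exists_pot_lower_bound hp one_pos hb
        obtain ⟨γ₀, hγ₀, HE⟩ := exists_energy_lower_bound n hp (half_pos hc)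
        filter_upwards [hγlim.eventually_lt_const hγ₀, eventually_gt_atTop R₀] with R hRγ hRR
        by_contra! hle
        have h := hsol R hRR
        have hR0 : 0 ≤ R := hR₀.le.trans hRR.le
        have h1 := HE _ hRγ _ _ h R (hnonneg R hRR) R ⟨hR0, le_rfl⟩
        have h2 := hcpot _ ⟨h.one_le_of_critical hR0 (hpos R hRR) (hzero R hRR), hle⟩
        simp only [hzero R hRR, mul_zero] at h1
        linarith
      · filter_upwards [eventually_gt_atTop R₀] with R hRR
        exact ((hsol R hRR).lt_homMax R (hR₀.le.trans hRR.le)).trans hb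
    simpa [Function.comp_def, homMax] using hlim.comp hsqrt
  · intro δ hδ ε hε
    obtain ⟨γ₀, hγ₀, T, HT⟩ := exists_transit_time_bound n hp hε
    have hev : ∀ᶠ R in atTop, ∀ a ∈ Icc (0:ℝ) ((1 - δ) * R), u (γ R) a < ε := by
      filter_upwards [hγlim.eventually_lt_const hγ₀, eventually_gt_atTop R₀,
        eventually_gt_atTop (T / δ)] with R hRγ hRR hRT a ha
      by_contra! hle
      have hR0 : 0 < R := hR₀.trans hRR
      have haR : a ≤ R := ha.2.trans (by nlinarith [hδ.1])
      have h1 := HT _ hRγ _ _ (hsol R hRR) R (hnonneg R hRR) a ⟨ha.1, haR⟩ hle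
      rw [div_lt_iff₀ hδ.1] at hRT
      linarith [ha.2]
    obtain ⟨Λ, hΛ⟩ := eventually_atTop.1 (hsqrt.eventually hev)
    refine ⟨Λ, fun lam hlam r hr => hΛ lam hlam _ ⟨mul_nonneg (sqrt_nonneg _) hr.1, ?_⟩⟩
    rw [mul_comm]
    exact mul_le_mul_of_nonneg_right hr.2 (sqrt_nonneg _)
end
end
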